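/- arXiv:1112.3587 — 4 statements merged into one kernel-verified Lean document; each statement's English description precedes it below -/
import Mathlib

section
/- Let D ⊂ ℝ² be a Jordan domain, let f : D → E ⊂ ℝ² be an orientation-preserving homeomorphism onto its image E = f(D), and let C be a connected component of D ∩ E. If f has no fixed point in C, then the non-escaping set of f in C is empty: { x ∈ C : fⁿ(x) ∈ C for all n ∈ ℕ } = ∅. -/
open Set Filter Topology

noncomputable section

/-- The real plane. -/
abbrev Plane : Type := EuclideanSpace ℝ (Fin 2)

/-- `f` restricted to `X` is a homeomorphism onto its image `Y`
(for compact `X`, a continuous injection is a homeomorphism onto its image). -/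
def IsHomeoOnto (f : Plane → Plane) (X Y : Set Plane) : Prop :=
  ContinuousOn f X ∧ Set.InjOn f X ∧ f '' X = Y

/-- `f : X → f(X)` is isotopic to the identity on `X`: there is a continuous family
of homeomorphisms (continuous injections, `X` being compact in applications)
`h_t : X → h_t(X)`, `t ∈ [0,1]`, with `h_0 = id_X` and `h_1 = f`. -/
def IsotopicToIdOn (f : Plane → Plane) (X : Set Plane) : Prop :=
  ∃ H : ℝ → Plane → Plane,
    ContinuousOn (fun p : ℝ × Plane => H p.1 p.2) (Set.Icc (0:ℝ) 1 ×ˢ X) ∧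
    (∀ x ∈ X, H 0 x = x) ∧
    (∀ x ∈ X, H 1 x = f x) ∧
    (∀ t ∈ Set.Icc (0:ℝ) 1, Set.InjOn (H t) X)

/-- A Jordan domain: a subset of the plane homeomorphic to the closed unit disk. -/
def IsJordanDomain (D : Set Plane) : Prop :=
  Nonempty (↥D ≃ₜ ↥(Metric.closedBall (0:Plane) 1))

/-- A self-homeomorphism of the plane is orientation-preserving iff it is isotopic to
the identity through homeomorphisms of the plane (note that a continuous bijection of the
plane is automatically a homeomorphism, by invariance of domain). -/
def IsOrientationPreservingPlaneHomeo (F : Plane ≃ₜ Plane) : Prop :=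
  ∃ H : ℝ → Plane → Plane,
    Continuous (fun p : ℝ × Plane => H p.1 p.2) ∧
    (∀ x, H 0 x = x) ∧
    (∀ x, H 1 x = F x) ∧
    (∀ t ∈ Set.Icc (0:ℝ) 1, Function.Bijective (H t))

/-- A homeomorphism between planar sets (here: the restriction of `f` to `X`) is
orientation-preserving if it extends to an orientation-preserving homeomorphism of the plane. -/
def OrientationPreservingOn (f : Plane → Plane) (X : Set Plane) : Prop :=
  ∃ F : Plane ≃ₜ Plane, IsOrientationPreservingPlaneHomeo F ∧ Set.EqOn f (⇑F) X

/-- A Jordan curve: the image of a topological embedding of the circle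
(a continuous injection of the compact circle, hence an embedding). -/
def IsJordanCurve (C : Set Plane) : Prop :=
  ∃ γ : Plane → Plane, ContinuousOn γ (Metric.sphere (0:Plane) 1) ∧
    Set.InjOn γ (Metric.sphere (0:Plane) 1) ∧
    γ '' Metric.sphere (0:Plane) 1 = C

theorem exists_continuousOn_extension {X Y : Type*} [TopologicalSpace X] [TopologicalSpace Y]
    [Nonempty Y] {s : Set X} {f : s → Y} (hf : Continuous f) :
    ∃ g : X → Y, ContinuousOn g s ∧ ∀ x : s, g x = f x := by
  classical
  refine ⟨fun x => if h : x ∈ s then f ⟨x, h⟩ else Classical.arbitrary Y, ?_, fun x => by simp⟩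
  rw [continuousOn_iff_continuous_domRestrict]
  convert hf using 1
  ext x
  simp

open unitInterval in
theorem exists_log_homotopy {X : Type*} [TopologicalSpace X] (g : I × X → ℂ)
    (hg : Continuous g) (hne : ∀ p, g p ≠ 0) (L₀ : X → ℂ) (hL₀ : Continuous L₀)
    (h : ∀ x, Complex.exp (L₀ x) = g (0, x)) :
    ∃ L : I × X → ℂ, Continuous L ∧ (∀ p, Complex.exp (L p) = g p) ∧ ∀ x, L (0, x) = L₀ x := by
  let H : C(I × X, {z : ℂ // z ≠ 0}) := ⟨fun p => ⟨g p, hne p⟩, by fun_prop⟩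
  have H0 : ∀ a, H (0, a) = (fun z : ℂ ↦ (⟨_, z.exp_ne_zero⟩ : {z : ℂ // z ≠ 0}))
      ((⟨L₀, hL₀⟩ : C(X, ℂ)) a) := fun a => Subtype.ext (h a).symm
  refine ⟨Complex.isCoveringMap_exp.liftHomotopy H ⟨L₀, hL₀⟩ H0, ContinuousMap.continuous _,
    fun p => ?_, fun x => ?_⟩
  · have := congrFun (Complex.isCoveringMap_exp.liftHomotopy_lifts H ⟨L₀, hL₀⟩ H0) p
    exact congrArg Subtype.val this
  · exact Complex.isCoveringMap_exp.liftHomotopy_zero H ⟨L₀, hL₀⟩ H0 x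

theorem IsPreconnected.log_sub_log_eq {X : Type*} [TopologicalSpace X] {s : Set X}
    (hs : IsPreconnected s) {L M : X → ℂ} (hL : ContinuousOn L s) (hM : ContinuousOn M s)
    (h : ∀ x ∈ s, Complex.exp (L x) = Complex.exp (M x)) {x y : X} (hx : x ∈ s) (hy : y ∈ s) :
    L x - M x = L y - M y := by
  set f : X → ℂ := fun x => (L x - M x) / (2 * Real.pi * Complex.I) with hf
  have hpi : (2 * Real.pi * Complex.I : ℂ) ≠ 0 := Complex.two_pi_I_ne_zero
  have hfc : ContinuousOn f s := (hL.sub hM).div_const _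
  have hT : ∀ x ∈ s, f x ∈ range ((↑) : ℤ → ℂ) := by
    intro x hx
    obtain ⟨n, hn⟩ := Complex.exp_eq_exp_iff_exists_int.1 (h x hx)
    refine ⟨n, ?_⟩
    rw [hf]; simp only
    rw [hn]; field_simp; ring
  have hcon := hs.image f hfc
  have : (f '' s).Subsingleton := by
    have hd : IsTotallyDisconnected (range ((↑) : ℤ → ℂ)) := by
      apply Set.Countable.isTotallyDisconnected
      exact countable_range _
    exact hd _ (by rintro _ ⟨x, hx, rfl⟩; exact hT x hx) hcon
  have e := this ⟨x, hx, rfl⟩ ⟨y, hy, rfl⟩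
  simp only [hf] at e
  exact (div_left_inj' hpi).1 e

/-- Multiplicative difference quotients of `F` have a continuous symmetric logarithm. -/
def HasLogQuotient (F : ℂ → ℂ) : Prop :=
  ∃ Θ : ℂ × ℂ → ℂ, ContinuousOn Θ {p | p.1 ≠ p.2} ∧ (∀ p q, p ≠ q → Θ (p, q) = Θ (q, p)) ∧
    ∀ p q, p ≠ q → F q - F p = (q - p) * Complex.exp (Θ (p, q))

theorem HasLogQuotient.comp {F G : ℂ → ℂ} (hF : HasLogQuotient F) (hG : HasLogQuotient G)
    (hc : Continuous G) (hi : Function.Injective G) : HasLogQuotient (F ∘ G) := by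
  obtain ⟨Θ, h1, h2, h3⟩ := hF
  obtain ⟨Ψ, k1, k2, k3⟩ := hG
  refine ⟨fun p => Θ (G p.1, G p.2) + Ψ p, ?_, ?_, ?_⟩
  · refine ContinuousOn.add (h1.comp (by fun_prop) ?_) k1
    intro p hp
    exact fun h => hp (hi h)
  · intro p q hpq
    simp only
    rw [h2 _ _ (fun h => hpq (hi h)), k2 _ _ hpq]
  · intro p q hpq
    simp only [Function.comp_apply]
    rw [h3 _ _ (fun h => hpq (hi h)), k3 _ _ hpq, Complex.exp_add]
    ring

theorem HasLogQuotient.symm {F : ℂ ≃ₜ ℂ} (hF : HasLogQuotient F) : HasLogQuotient F.symm := by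
  obtain ⟨Θ, h1, h2, h3⟩ := hF
  refine ⟨fun p => - Θ (F.symm p.1, F.symm p.2), ?_, ?_, ?_⟩
  · refine ContinuousOn.neg (h1.comp (by fun_prop) ?_)
    intro p hp
    exact fun h => hp (F.symm.injective h)
  · intro p q hpq
    simp only
    rw [h2 _ _ (fun h => hpq (F.symm.injective h))]
  · intro p q hpq
    have := h3 _ _ (fun h => hpq (F.symm.injective h))
    rw [F.apply_symm_apply, F.apply_symm_apply] at this
    rw [this, mul_assoc, ← Complex.exp_add]
    simp

/-- An isotopy to the identity yields a logarithm of the difference quotients. -/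
theorem hasLogQuotient_of_isotopy {F : ℂ → ℂ} (H : ℝ → ℂ → ℂ)
    (hc : Continuous fun p : ℝ × ℂ => H p.1 p.2) (h0 : ∀ x, H 0 x = x) (h1 : ∀ x, H 1 x = F x)
    (hi : ∀ t ∈ Icc (0 : ℝ) 1, Function.Injective (H t)) : HasLogQuotient F := by
  let X := {p : ℂ × ℂ // p.1 ≠ p.2}
  have hX : ∀ p : X, p.1.2 - p.1.1 ≠ 0 := fun p => sub_ne_zero.2 p.2.symm
  let g : unitInterval × X → ℂ := fun p =>
    (H p.1 p.2.1.2 - H p.1 p.2.1.1) / (p.2.1.2 - p.2.1.1)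
  have cv : Continuous fun p : unitInterval × X => p.2.1 :=
    continuous_subtype_val.comp continuous_snd
  have hg : Continuous g := by
    refine Continuous.div ?_ (cv.snd.sub cv.fst) (fun p => hX p.2)
    have a : Continuous fun p : unitInterval × X => H p.1 p.2.1.2 :=
      hc.comp (f := fun p : unitInterval × X => ((p.1 : ℝ), p.2.1.2))
        ((continuous_subtype_val.comp continuous_fst).prodMk cv.snd)
    have b : Continuous fun p : unitInterval × X => H p.1 p.2.1.1 :=
      hc.comp (f := fun p : unitInterval × X => ((p.1 : ℝ), p.2.1.1))
        ((continuous_subtype_val.comp continuous_fst).prodMk cv.fst)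
    exact a.sub b
  have hne : ∀ p, g p ≠ 0 := fun p => div_ne_zero
    (sub_ne_zero.2 fun e => p.2.2 (hi p.1 p.1.2 e).symm) (hX p.2)
  obtain ⟨L, hL, hLe, hL0⟩ := exists_log_homotopy g hg hne (fun _ => 0) continuous_const
    (fun x => by simp only [g]; simp [h0, hX x])
  have hsymm : ∀ p : X, L (1, p) = L (1, ⟨(p.1.2, p.1.1), Ne.symm p.2⟩) := by
    intro p
    let q : X := ⟨(p.1.2, p.1.1), Ne.symm p.2⟩
    have := isPreconnected_univ.log_sub_log_eq (s := (univ : Set unitInterval))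
      (L := fun t => L (t, p)) (M := fun t => L (t, q))
      (hL.comp (continuous_id.prodMk continuous_const)).continuousOn
      (hL.comp (continuous_id.prodMk continuous_const)).continuousOn ?_ (mem_univ 1) (mem_univ 0)
    · simpa [hL0, sub_eq_zero] using this
    · intro t _
      simp only [hLe, g, q]
      rw [← neg_div_neg_eq]; simp
  obtain ⟨Θ, hΘ, hΘL⟩ := exists_continuousOn_extension (s := {p : ℂ × ℂ | p.1 ≠ p.2})
    (f := fun p => L (1, p)) (hL.comp (by fun_prop))
  have hΘL' : ∀ p q (h : p ≠ q), Θ (p, q) = L (1, ⟨(p, q), h⟩) := fun p q h => hΘL ⟨(p, q), h⟩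
  refine ⟨Θ, hΘ, ?_, ?_⟩
  · intro p q hpq
    rw [hΘL' p q hpq, hΘL' q p hpq.symm]
    exact hsymm ⟨(p, q), hpq⟩
  · intro p q hpq
    rw [hΘL' p q hpq, hLe]
    simp only [g, Icc.coe_one, h1]
    rw [mul_div_cancel₀]
    exact sub_ne_zero.2 hpq.symm

/-- A starlike (with respect to the origin) set carries logarithms of nonvanishing functions. -/
theorem exists_log_of_starConvex {s : Set ℂ} (hs : StarConvex ℝ 0 s) {g : ℂ → ℂ}
    (hg : ContinuousOn g s) (hne : ∀ z ∈ s, g z ≠ 0) :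
    ∃ L : ℂ → ℂ, ContinuousOn L s ∧ ∀ z ∈ s, Complex.exp (L z) = g z := by
  have hmem : ∀ p : unitInterval × s, ((p.1 : ℝ) • (p.2 : ℂ)) ∈ s := fun p =>
    hs.smul_mem p.2.2 p.1.2.1 p.1.2.2
  rcases s.eq_empty_or_nonempty with rfl | hne'
  · exact ⟨fun _ => 0, by simp, by simp⟩
  have h0 : (0 : ℂ) ∈ s := hs.mem hne'
  obtain ⟨L, hL, hLe, -⟩ := exists_log_homotopy (X := s) (fun p => g ((p.1 : ℝ) • (p.2 : ℂ)))
    (hg.comp_continuous (by fun_prop) hmem) (fun p => hne _ (hmem p))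
    (fun _ => Complex.log (g 0)) continuous_const
    (fun x => by simp [Complex.exp_log (hne _ h0)])
  obtain ⟨M, hM, hML⟩ := exists_continuousOn_extension (s := s)
    (f := fun p => L (1, p)) (hL.comp (by fun_prop))
  refine ⟨M, hM, fun z hz => ?_⟩
  rw [hML ⟨z, hz⟩, hLe]
  simp

theorem exists_homeomorph_push (p q : ℂ) {r : ℝ} (hr : dist q p < r) :
    ∃ φ : ℂ ≃ₜ ℂ, HasLogQuotient φ ∧ φ p = q ∧ ∀ u ∉ Metric.ball p r, φ u = u := by
  have hr0 : 0 < r := dist_nonneg.trans_lt hr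
  set c : ℝ := dist q p / r with hc
  have hc0 : 0 ≤ c := by positivity
  have hc1 : c < 1 := (div_lt_one hr0).2 hr
  set h : ℂ → ℂ := fun u => ((max 0 (1 - ‖u - p‖ / r) : ℝ) : ℂ) * (q - p) with hh
  have hlip : ∀ u v, ‖h u - h v‖ ≤ c * ‖u - v‖ := by
    intro u v
    simp only [hh]
    rw [← sub_mul, norm_mul, ← Complex.ofReal_sub, Complex.norm_real, hc, dist_eq_norm]
    have : ‖max 0 (1 - ‖u - p‖ / r) - max 0 (1 - ‖v - p‖ / r)‖ ≤ ‖u - v‖ / r := by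
      rw [Real.norm_eq_abs]
      refine (abs_max_sub_max_le_max _ _ _ _).trans ?_
      simp only [sub_self, abs_zero]
      refine max_le (by positivity) ?_
      have e : 1 - ‖u - p‖ / r - (1 - ‖v - p‖ / r) = (‖v - p‖ - ‖u - p‖) / r := by ring
      rw [e, abs_div, abs_of_pos hr0]
      gcongr
      refine (abs_norm_sub_norm_le _ _).trans ?_
      rw [← norm_neg]; simp
    calc _ ≤ ‖u - v‖ / r * ‖q - p‖ := by gcongr
      _ = _ := by ring
  let C : NNReal := ⟨c, hc0⟩
  have happ : ApproximatesLinearOn (fun u => u + h u)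
      ((ContinuousLinearEquiv.refl ℝ ℂ : ℂ ≃L[ℝ] ℂ) : ℂ →L[ℝ] ℂ) univ C := by
    intro u _ v _
    have e : u + h u - (v + h v) - (u - v) = h u - h v := by ring
    change ‖u + h u - (v + h v) - (u - v)‖ ≤ c * ‖u - v‖
    rw [e]
    exact hlip u v
  let φ : ℂ ≃ₜ ℂ := happ.toHomeomorph _ (Or.inr (by
    have : ‖((ContinuousLinearEquiv.refl ℝ ℂ).symm : ℂ →L[ℝ] ℂ)‖₊ = 1 := by
      ext; exact ContinuousLinearMap.norm_id
    rw [this, inv_one, ← NNReal.coe_lt_coe]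
    exact hc1))
  have hφ : ∀ u, φ u = u + h u := fun u => rfl
  have hhc : Continuous h := by
    simp only [hh]; fun_prop
  refine ⟨φ, ⟨fun x => Complex.log (1 + (h x.2 - h x.1) / (x.2 - x.1)), ?_, ?_, ?_⟩, ?_, ?_⟩
  · intro x hx
    refine ContinuousAt.continuousWithinAt ?_
    have hx' : x.2 - x.1 ≠ 0 := sub_ne_zero.2 (Ne.symm hx)
    refine ContinuousAt.clog (by fun_prop (disch := assumption)) ?_
    refine Complex.mem_slitPlane_of_norm_lt_one ?_
    rw [norm_div, div_lt_one (norm_pos_iff.2 hx')]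
    refine (hlip _ _).trans_lt ?_
    have := norm_pos_iff.2 hx'
    nlinarith
  · intro x y hxy
    simp only
    rw [← neg_div_neg_eq]; simp
  · intro x y hxy
    have hx' : y - x ≠ 0 := sub_ne_zero.2 (Ne.symm hxy)
    simp only
    rw [Complex.exp_log, hφ, hφ]
    · field_simp; ring
    · refine Complex.slitPlane_ne_zero (Complex.mem_slitPlane_of_norm_lt_one ?_)
      rw [norm_div, div_lt_one (norm_pos_iff.2 hx')]
      refine (hlip _ _).trans_lt ?_
      have := norm_pos_iff.2 hx'
      nlinarith
  · simp [hφ, hh]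
  · intro u hu
    rw [hφ]
    have : 1 - ‖u - p‖ / r ≤ 0 := by
      rw [Metric.mem_ball, dist_eq_norm, not_lt] at hu
      rw [sub_nonpos, one_le_div hr0]; exact hu
    simp [hh, max_eq_left this]

theorem Homeomorph.apply_mem_iff_of_eqOn_compl {X : Type*} [TopologicalSpace X] {φ : X ≃ₜ X}
    {W V : Set X} (h : ∀ u ∉ W, φ u = u) (hWV : W ⊆ V) (u : X) : φ u ∈ V ↔ u ∈ V := by
  have key : ∀ u, φ u ∈ W ↔ u ∈ W := by
    intro u
    constructor
    · intro hu
      by_contra hn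
      rw [h u hn] at hu
      exact hn hu
    · intro hu
      by_contra hn
      have := φ.injective (h _ hn)
      rw [this] at hn
      exact hn hu
  by_cases hu : u ∈ W
  · exact iff_of_true (hWV ((key u).2 hu)) (hWV hu)
  · rw [h u hu]

theorem Homeomorph.symm_apply_eq_of_eqOn_compl {X : Type*} [TopologicalSpace X] {φ : X ≃ₜ X}
    {W : Set X} (h : ∀ u ∉ W, φ u = u) : ∀ u ∉ W, φ.symm u = u := fun u hu => by
  rw [φ.symm_apply_eq, h u hu]

/-- Homogeneity of connected open subsets of the plane. -/
theorem IsPreconnected.exists_homeomorph_apply_eq {W : Set ℂ} (hW : IsOpen W)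
    (hWc : IsPreconnected W) {p q : ℂ} (hp : p ∈ W) (hq : q ∈ W) :
    ∃ φ : ℂ ≃ₜ ℂ, HasLogQuotient φ ∧ φ p = q ∧ ∀ u ∉ W, φ u = u := by
  let P : ℂ → ℂ → Prop := fun p q =>
    ∃ φ : ℂ ≃ₜ ℂ, HasLogQuotient φ ∧ φ p = q ∧ ∀ u ∉ W, φ u = u
  have hsymm : ∀ p q, P p q → P q p := by
    rintro p q ⟨φ, h1, h2, h3⟩
    exact ⟨φ.symm, h1.symm, by rw [φ.symm_apply_eq, h2],
      Homeomorph.symm_apply_eq_of_eqOn_compl h3⟩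
  refine hWc.induction₂ P ?_ ?_ ?_ hp hq
  · intro x hx
    obtain ⟨r, hr, hrW⟩ := Metric.isOpen_iff.1 hW x hx
    filter_upwards [mem_nhdsWithin_of_mem_nhds (Metric.ball_mem_nhds x hr)] with y hy
    obtain ⟨φ, h1, h2, h3⟩ := exists_homeomorph_push x y hy
    exact ⟨φ, h1, h2, fun u hu => h3 u fun h => hu (hrW h)⟩
  · rintro x y z - - - ⟨φ, h1, h2, h3⟩ ⟨ψ, k1, k2, k3⟩
    refine ⟨φ.trans ψ, k1.comp h1 φ.continuous φ.injective, by simp [h2, k2], fun u hu => ?_⟩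
    simp [h3 u hu, k3 u hu]
  · rintro x y - - h
    exact hsymm _ _ h

theorem isPreconnected_ball_diff_center (t : ℂ) (r : ℝ) :
    IsPreconnected (Metric.ball t r \ {t}) := by
  have : Metric.ball t r \ {t} =
      (fun p : ℝ × ℝ => t + p.1 * Complex.exp (p.2 * Complex.I)) '' (Ioo 0 r ×ˢ univ) := by
    ext z
    constructor
    · rintro ⟨hz, hzt⟩
      rw [Metric.mem_ball, dist_eq_norm] at hz
      refine ⟨(‖z - t‖, Complex.arg (z - t)), ⟨⟨norm_pos_iff.2 (sub_ne_zero.2 hzt), hz⟩,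
        mem_univ _⟩, ?_⟩
      simp only [Complex.norm_mul_exp_arg_mul_I]; ring
    · rintro ⟨⟨s, θ⟩, ⟨⟨h1, h2⟩, -⟩, rfl⟩
      have : ‖(s : ℂ) * Complex.exp (θ * Complex.I)‖ = s := by
        rw [norm_mul, Complex.norm_exp_ofReal_mul_I, Complex.norm_real, mul_one,
          Real.norm_of_nonneg h1.le]
      refine ⟨by simpa [dist_eq_norm, abs_of_pos h1] using h2, ?_⟩
      simp [h1.ne']
  rw [this]
  refine IsPreconnected.image (isPreconnected_Ioo.prod isPreconnected_univ) _ ?_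
  fun_prop

theorem IsPreconnected.diff_singleton {W : Set ℂ} (hW : IsOpen W) (hWc : IsPreconnected W)
    (t : ℂ) : IsPreconnected (W \ {t}) := by
  by_cases ht : t ∈ W
  swap
  · rwa [sdiff_singleton_eq_self ht]
  obtain ⟨r, hr, hrW⟩ := Metric.isOpen_iff.1 hW t ht
  have hb := isPreconnected_ball_diff_center t r
  have hbW : Metric.ball t r \ {t} ⊆ W \ {t} := sdiff_subset_sdiff_left hrW
  have key : ∀ A B : Set ℂ, IsOpen A → IsOpen B → W \ {t} ⊆ A ∪ B →
      (W \ {t}) ∩ (A ∩ B) = ∅ → Metric.ball t r \ {t} ⊆ A → (W \ {t}) ∩ B = ∅ := by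
    intro A B hA hB hAB hd hbA
    by_contra hne
    obtain ⟨z, ⟨hzW, hzt⟩, hzB⟩ := nonempty_iff_ne_empty.2 hne
    have hsub : W ⊆ (A ∪ Metric.ball t r) ∪ B \ {t} := by
      intro y hy
      by_cases hyt : y = t
      · exact Or.inl (Or.inr (by rw [hyt]; exact Metric.mem_ball_self hr))
      · rcases hAB ⟨hy, hyt⟩ with h | h
        · exact Or.inl (Or.inl h)
        · exact Or.inr ⟨h, hyt⟩
    obtain ⟨y, hyW, hy1, hy2⟩ := hWc (A ∪ Metric.ball t r) (B \ {t})
      (hA.union Metric.isOpen_ball) (hB.sdiff isClosed_singleton) hsub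
      ⟨t, ht, Or.inr (Metric.mem_ball_self hr)⟩ ⟨z, hzW, hzB, hzt⟩
    have hyA : y ∈ A := by
      rcases hy1 with h | h
      · exact h
      · exact hbA ⟨h, hy2.2⟩
    exact (eq_empty_iff_forall_notMem.1 hd y) ⟨⟨hyW, hy2.2⟩, hyA, hy2.1⟩
  rw [isPreconnected_iff_subset_of_disjoint]
  intro A B hA hB hAB hd
  have hd' : (W \ {t}) ∩ (B ∩ A) = ∅ := by rwa [inter_comm B A]
  have hAB' : W \ {t} ⊆ B ∪ A := by rwa [union_comm]
  have fin : ∀ A B : Set ℂ, W \ {t} ⊆ A ∪ B → (W \ {t}) ∩ B = ∅ → W \ {t} ⊆ A := by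
    intro A B h1 h2 z hz
    rcases h1 hz with h | h
    · exact h
    · exact absurd ⟨hz, h⟩ (eq_empty_iff_forall_notMem.1 h2 z)
  rcases (isPreconnected_iff_subset_of_disjoint.1 hb) A B hA hB (hbW.trans hAB)
    (subset_empty_iff.1 ((inter_subset_inter_left _ hbW).trans hd.subset)) with h | h
  · exact Or.inl (fin A B hAB (key A B hA hB hAB hd h))
  · exact Or.inr (fin B A hAB' (key B A hB hA hAB' hd' h))

theorem IsPreconnected.diff_finite {W : Set ℂ} (hW : IsOpen W) (hWc : IsPreconnected W)
    {T : Set ℂ} (hT : T.Finite) : IsPreconnected (W \ T) := by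
  induction T, hT using Set.Finite.induction_on with
  | empty => simpa
  | @insert a S _ hS ih =>
    have : W \ insert a S = (W \ S) \ {a} := by
      ext z; simp; tauto
    rw [this]
    exact ih.diff_singleton (hW.sdiff hS.isClosed) a

theorem ContinuousOn.exists_continuous_eqOn {X : Type*} [TopologicalSpace X] [NormalSpace X]
    {s : Set X} (hs : IsClosed s) {f : X → ℂ} (hf : ContinuousOn f s) :
    ∃ g : X → ℂ, Continuous g ∧ EqOn g f s := by
  obtain ⟨g, hg⟩ := ContinuousMap.exists_restrict_eq hs
    (⟨s.domRestrict f, continuousOn_iff_continuous_domRestrict.1 hf⟩ : C(s, ℂ))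
  exact ⟨g, g.continuous, fun x hx => congrArg (fun h : C(s, ℂ) => h ⟨x, hx⟩) hg⟩

theorem exists_homeomorph_finite_norm_ge {K : Set ℂ} (hK : IsClosed K)
    (hKc : IsPreconnected Kᶜ) {R : ℝ} (hKR : ∀ z ∈ K, ‖z‖ < R) {T : Set ℂ} (hT : T.Finite) (hTK : T ⊆ Kᶜ) :
    ∃ κ : ℂ ≃ₜ ℂ, (∀ u ∈ K, κ u = u) ∧ ∀ t ∈ T, R ≤ ‖κ t‖ := by
  induction T, hT using Set.Finite.induction_on with
  | empty => exact ⟨Homeomorph.refl ℂ, fun _ _ => rfl, by simp⟩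
  | @insert a S ha hS ih =>
    obtain ⟨κ, hκ, hκS⟩ := ih ((subset_insert a S).trans hTK)
    have hfar : {z : ℂ | R ≤ ‖z‖}.Infinite := by
      refine ((Ici_infinite (max R 0)).image
        (Complex.ofReal_injective.injOn (s := Ici (max R 0)))).mono ?_
      rintro _ ⟨x, hx, rfl⟩
      have hx' := max_le_iff.1 (mem_Ici.1 hx)
      simpa [abs_of_nonneg hx'.2] using hx'.1
    obtain ⟨q, hqR, hq⟩ := hfar.exists_notMem_finite (hS.image κ)
    have hW : IsOpen (Kᶜ \ κ '' S) := hK.isOpen_compl.sdiff (hS.image κ).isClosed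
    have haK : κ a ∈ Kᶜ \ κ '' S := by
      refine ⟨fun h => hTK (mem_insert a S) ?_, ?_⟩
      · have := κ.injective (hκ _ h)
        rwa [this] at h
      · rintro ⟨b, hb, hab⟩
        exact ha (κ.injective hab ▸ hb)
    obtain ⟨φ, -, h2, h3⟩ := (hKc.diff_finite hK.isOpen_compl (hS.image κ)).exists_homeomorph_apply_eq
        hW haK ⟨fun h => (hKR q h).not_ge hqR, hq⟩
    refine ⟨κ.trans φ, fun u hu => ?_, fun t ht => ?_⟩
    · rw [Homeomorph.trans_apply, hκ u hu, h3 u (fun h => h.1 hu)]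
    · rw [Homeomorph.trans_apply]
      rcases mem_insert_iff.1 ht with rfl | ht
      · rwa [h2]
      · rw [h3 _ (fun h => h.2 (mem_image_of_mem κ ht))]
        exact hκS t ht

theorem exists_small_regular_value {P : ℂ → ℂ} (hP : ContDiff ℝ 1 P) {ε : ℝ} (hε : 0 < ε) :
    ∃ w, ‖w‖ < ε ∧ ∀ z, P z = w → (fderiv ℝ P z).det ≠ 0 := by
  have h := MeasureTheory.addHaar_image_eq_zero_of_det_fderivWithin_eq_zero
    MeasureTheory.volume (f := P) (f' := fderiv ℝ P) (s := {z | (fderiv ℝ P z).det = 0})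
    (fun x _ => ((hP.differentiable (by norm_num)) x).hasFDerivAt.hasFDerivWithinAt)
    (fun x hx => hx)
  by_contra! hcon
  have : Metric.ball (0 : ℂ) ε ⊆ P '' {z | (fderiv ℝ P z).det = 0} := by
    intro w hw
    obtain ⟨z, hz, hd⟩ := hcon w (by simpa using hw)
    exact ⟨z, hd, hz⟩
  have h2 := MeasureTheory.measure_mono_null this h
  exact (Metric.measure_ball_pos MeasureTheory.volume (0 : ℂ) hε).ne' h2

theorem finite_preimage_of_det_fderiv_ne_zero {P : ℂ → ℂ} (hP : ContDiff ℝ 1 P) {w : ℂ}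
    (hw : ∀ z, P z = w → (fderiv ℝ P z).det ≠ 0) {R : ℝ} (hR : ∀ z, P z = w → ‖z‖ ≤ R) :
    {z | P z = w}.Finite := by
  by_contra hinf
  obtain ⟨x, -, hx⟩ := Set.Infinite.exists_accPt_of_subset_isCompact hinf
    (isCompact_closedBall (0 : ℂ) R) (fun z hz => by simpa using hR z hz)
  rw [accPt_iff_frequently_nhdsNE] at hx
  by_cases hPx : P x = w
  · refine hx ?_
    refine HasFDerivAt.eventually_ne ((hP.differentiable (by norm_num)) x).hasFDerivAt ?_
    let e := (fderiv ℝ P x).toContinuousLinearEquivOfDetNeZero (hw x hPx)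
    exact ⟨_, e.antilipschitz⟩
  · refine hx ?_
    exact mem_nhdsWithin_of_mem_nhds (hP.continuous.continuousAt.eventually_ne hPx)

/-- A nonvanishing continuous function on a compact subset of the plane with connected
complement has a continuous logarithm. -/
theorem IsCompact.exists_log {K : Set ℂ} (hK : IsCompact K) (hKc : IsPreconnected Kᶜ)
    {g : ℂ → ℂ} (hg : ContinuousOn g K) (hne : ∀ z ∈ K, g z ≠ 0) :
    ∃ L : ℂ → ℂ, ContinuousOn L K ∧ ∀ z ∈ K, Complex.exp (L z) = g z := by
  rcases K.eq_empty_or_nonempty with rfl | hKn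
  · exact ⟨fun _ => 0, by simp, by simp⟩
  obtain ⟨R, hR⟩ := hK.isBounded.subset_ball 0
  have hKR : ∀ z ∈ K, ‖z‖ < R := fun z hz => by simpa using hR hz
  obtain ⟨m, hm, hmK⟩ : ∃ m > 0, ∀ z ∈ K, m ≤ ‖g z‖ := by
    obtain ⟨z₀, hz₀, h⟩ := hK.exists_isMinOn hKn hg.norm
    exact ⟨‖g z₀‖, norm_pos_iff.2 (hne _ hz₀), fun z hz => h hz⟩
  have hF : IsClosed {z : ℂ | R ≤ ‖z‖} := isClosed_le continuous_const continuous_norm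
  classical
  obtain ⟨G, hG, hGe⟩ := ContinuousOn.exists_continuous_eqOn (s := K ∪ {z : ℂ | R ≤ ‖z‖})
    (f := fun z => if R ≤ ‖z‖ then 1 else g z) (hK.isClosed.union hF) (by
      refine ContinuousOn.union_of_isClosed ?_ ?_ hK.isClosed hF
      · exact hg.congr fun z hz => if_neg (not_le.2 (hKR z hz))
      · exact (continuousOn_const (c := (1 : ℂ))).congr fun z hz => if_pos hz)
  have hGK : ∀ z ∈ K, G z = g z := fun z hz => by
    rw [hGe (Or.inl hz)]; exact if_neg (not_le.2 (hKR z hz))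
  have hGR : ∀ z, R ≤ ‖z‖ → G z = 1 := fun z hz => by
    rw [hGe (Or.inr hz)]; exact if_pos hz
  set ε := min (m / 3) (1 / 3) with hε
  have hε0 : 0 < ε := by positivity
  obtain ⟨P, hP, hPG, -⟩ := hG.exists_contDiff_approx 1 (continuous_const (y := ε)) (fun _ => hε0)
  obtain ⟨w, hw, hreg⟩ := exists_small_regular_value (P := P) (by exact_mod_cast hP) hε0
  have hclose : ∀ z, ‖P z - w - G z‖ < 2 * ε := fun z => by
    have := hPG z
    rw [dist_eq_norm] at this
    calc ‖P z - w - G z‖ = ‖(P z - G z) - w‖ := by ring_nf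
      _ ≤ ‖P z - G z‖ + ‖w‖ := norm_sub_le _ _
      _ < _ := by linarith
  have hε1 : ε ≤ m / 3 := min_le_left _ _
  have hε2 : ε ≤ 1 / 3 := min_le_right _ _
  have hzeroR : ∀ z, P z = w → ‖z‖ < R := by
    intro z hz
    by_contra! hzR
    have := hclose z
    rw [hz, hGR z hzR] at this
    simp at this; linarith
  have hKlt : ∀ z ∈ K, ‖P z - w - g z‖ < ‖g z‖ := by
    intro z hz
    have := hclose z
    rw [hGK z hz] at this
    have := hmK z hz
    linarith
  have hzeroK : {z | P z = w} ⊆ Kᶜ := by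
    intro z hz hzK
    have := hKlt z hzK
    rw [mem_ofPred_eq] at hz
    simp [hz] at this
  obtain ⟨κ, hκ, hκR⟩ := exists_homeomorph_finite_norm_ge hK.isClosed hKc hKR
    (finite_preimage_of_det_fderiv_ne_zero (by exact_mod_cast hP) hreg
      (fun z hz => (hzeroR z hz).le)) hzeroK
  obtain ⟨M, hM, hMe⟩ := exists_log_of_starConvex (s := Metric.ball 0 R)
    (g := fun z => P (κ.symm z) - w)
    ((convex_ball 0 R).starConvex (by
      obtain ⟨z, hz⟩ := hKn
      simpa using (norm_nonneg z).trans_lt (hKR z hz)))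
    ((hP.continuous.comp κ.symm.continuous).sub continuous_const).continuousOn
    (fun z hz h => by
      have := hκR (κ.symm z) (sub_eq_zero.1 h)
      rw [κ.apply_symm_apply] at this
      simp at hz
      linarith)
  have hMK : ∀ z ∈ K, Complex.exp (M z) = P z - w := fun z hz => by
    rw [hMe z (hR hz)]
    rw [show κ.symm z = z by rw [κ.symm_apply_eq, hκ z hz]]
  have hslit : ∀ z ∈ K, (P z - w) / g z ∈ Complex.slitPlane := by
    intro z hz
    have : (P z - w) / g z = 1 + (P z - w - g z) / g z := by
      have := hne z hz
      field_simp; ring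
    rw [this]
    refine Complex.mem_slitPlane_of_norm_lt_one ?_
    rw [norm_div, div_lt_one (norm_pos_iff.2 (hne z hz))]
    exact hKlt z hz
  refine ⟨fun z => M z - Complex.log ((P z - w) / g z), ?_, fun z hz => ?_⟩
  · refine (hM.mono hR).sub (ContinuousOn.clog ?_ hslit)
    exact (hP.continuous.sub continuous_const).continuousOn.div hg hne
  · have h1 := Complex.slitPlane_ne_zero (hslit z hz)
    have h2 := hne z hz
    have h3 : P z - w ≠ 0 := fun h => h1 (by rw [h, zero_div])
    rw [Complex.exp_sub, hMK z hz, Complex.exp_log h1]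
    field_simp

/-- The points joined to infinity by a connected set avoiding `S`. -/
def outer (S : Set ℂ) : Set ℂ :=
  {z | ∃ T : Set ℂ, IsPreconnected T ∧ z ∈ T ∧ T ⊆ Sᶜ ∧ ¬ Bornology.IsBounded T}

theorem subset_outer {S T : Set ℂ} (hT : IsPreconnected T) (hTS : T ⊆ Sᶜ)
    (hb : ¬ Bornology.IsBounded T) : T ⊆ outer S := fun _ hz => ⟨T, hT, hz, hTS, hb⟩

theorem outer_subset_compl (S : Set ℂ) : outer S ⊆ Sᶜ := fun _ ⟨_, _, hz, h, _⟩ => h hz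

theorem outer_anti {S S' : Set ℂ} (h : S ⊆ S') : outer S' ⊆ outer S :=
  fun _ ⟨T, h1, h2, h3, h4⟩ => ⟨T, h1, h2, h3.trans (compl_subset_compl.2 h), h4⟩

theorem isPreconnected_setOf_le_norm {R : ℝ} (hR : 0 ≤ R) : IsPreconnected {z : ℂ | R ≤ ‖z‖} := by
  have : {z : ℂ | R ≤ ‖z‖} =
      (fun p : ℝ × ℝ => (p.1 : ℂ) * Complex.exp (p.2 * Complex.I)) '' (Ici R ×ˢ univ) := by
    ext z
    constructor
    · intro hz
      exact ⟨(‖z‖, Complex.arg z), ⟨hz, mem_univ _⟩, Complex.norm_mul_exp_arg_mul_I z⟩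
    · rintro ⟨⟨s, θ⟩, ⟨h1, -⟩, rfl⟩
      rw [mem_Ici] at h1
      rw [mem_ofPred_eq, norm_mul, Complex.norm_exp_ofReal_mul_I, Complex.norm_real, mul_one,
          Real.norm_of_nonneg (hR.trans h1)]
      exact h1
  rw [this]
  exact (isPreconnected_Ici.prod isPreconnected_univ).image _ (by fun_prop)

theorem not_isBounded_of_setOf_le_norm_subset {R : ℝ} {T : Set ℂ} (h : {z : ℂ | R ≤ ‖z‖} ⊆ T) :
    ¬ Bornology.IsBounded T := by
  intro hb
  obtain ⟨r, hr⟩ := (hb.subset h).exists_norm_le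
  have := hr ((max R (|r| + 1) : ℝ) : ℂ) (by
    rw [mem_ofPred_eq, Complex.norm_real]
    exact (le_max_left _ _).trans (le_abs_self _))
  rw [Complex.norm_real] at this
  have h2 := (le_max_right R (|r| + 1)).trans (le_abs_self (max R (|r| + 1)))
  have h3 := le_abs_self r
  rw [Real.norm_eq_abs] at this
  linarith

theorem exists_le_norm_of_not_isBounded {T : Set ℂ} (h : ¬ Bornology.IsBounded T) (R : ℝ) :
    ∃ z ∈ T, R ≤ ‖z‖ := by
  by_contra! hc
  exact h (isBounded_iff_forall_norm_le.2 ⟨R, fun z hz => (hc z hz).le⟩)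

theorem setOf_le_norm_subset_outer {S : Set ℂ} {R : ℝ} (hR : 0 ≤ R) (hS : ∀ z ∈ S, ‖z‖ < R) :
    {z : ℂ | R ≤ ‖z‖} ⊆ outer S :=
  subset_outer (isPreconnected_setOf_le_norm hR) (fun z hz h => (hS z h).not_ge hz)
    (not_isBounded_of_setOf_le_norm_subset Subset.rfl)

theorem exists_pos_forall_norm_lt {S : Set ℂ} (hS : Bornology.IsBounded S) :
    ∃ R > 0, ∀ z ∈ S, ‖z‖ < R := by
  obtain ⟨R, hR0, hR⟩ := hS.exists_pos_norm_lt
  exact ⟨R, hR0, hR⟩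

theorem not_isBounded_outer {S : Set ℂ} (hS : Bornology.IsBounded S) :
    ¬ Bornology.IsBounded (outer S) := by
  obtain ⟨R, hR0, hR⟩ := exists_pos_forall_norm_lt hS
  exact not_isBounded_of_setOf_le_norm_subset (setOf_le_norm_subset_outer hR0.le hR)

theorem isPreconnected_outer {S : Set ℂ} (hS : Bornology.IsBounded S) :
    IsPreconnected (outer S) := by
  obtain ⟨R, hR0, hR⟩ := exists_pos_forall_norm_lt hS
  have hE := setOf_le_norm_subset_outer hR0.le hR
  have hR' : (R : ℂ) ∈ {z : ℂ | R ≤ ‖z‖} := by simp [abs_of_pos hR0]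
  refine isPreconnected_of_forall (R : ℂ) fun z hz => ?_
  obtain ⟨T, h1, h2, h3, h4⟩ := id hz
  obtain ⟨y, hyT, hy⟩ := exists_le_norm_of_not_isBounded h4 R
  exact ⟨{z : ℂ | R ≤ ‖z‖} ∪ T, union_subset hE (subset_outer h1 h3 h4), Or.inl hR', Or.inr h2,
    (isPreconnected_setOf_le_norm hR0.le).union y hy hyT h1⟩

theorem isOpen_outer {S : Set ℂ} (hS : IsClosed S) : IsOpen (outer S) := by
  rw [Metric.isOpen_iff]
  rintro z ⟨T, h1, h2, h3, h4⟩
  obtain ⟨r, hr, hrS⟩ := Metric.isOpen_iff.1 hS.isOpen_compl z (h3 h2)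
  refine ⟨r, hr, subset_union_right.trans (subset_outer (T := T ∪ Metric.ball z r)
    (h1.union z h2 (Metric.mem_ball_self hr) (convex_ball z r).isPreconnected)
    (union_subset h3 hrS) fun h => h4 (h.subset subset_union_left))⟩

theorem isClosed_outer {S : Set ℂ} (hS : IsOpen S) (hb : Bornology.IsBounded S) :
    IsClosed (outer S) := by
  refine isClosed_of_closure_subset (subset_outer (isPreconnected_outer hb).closure ?_ ?_)
  · exact closure_minimal (outer_subset_compl S) hS.isClosed_compl
  · exact fun h => not_isBounded_outer hb (h.subset subset_closure)

theorem exists_bounded_component {S : Set ℂ} (hS : IsClosed S) {a : ℂ}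
    (haS : a ∉ S) (ha : a ∉ outer S) :
    ∃ W : Set ℂ, IsOpen W ∧ IsPreconnected W ∧ a ∈ W ∧ Bornology.IsBounded W ∧ W ⊆ (outer S)ᶜ ∧
      closure W ⊆ W ∪ S := by
  set W := connectedComponentIn Sᶜ a with hW
  have haW : a ∈ W := mem_connectedComponentIn haS
  have hWc : IsPreconnected W := isPreconnected_connectedComponentIn
  have hWS : W ⊆ Sᶜ := connectedComponentIn_subset _ _
  refine ⟨W, hS.isOpen_compl.connectedComponentIn, hWc, haW, ?_, ?_, ?_⟩
  · by_contra hb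
    exact ha ⟨W, hWc, haW, hWS, hb⟩
  · rintro z hz ⟨T, h1, h2, h3, h4⟩
    exact ha ⟨W ∪ T, hWc.union z hz h2 h1, Or.inl haW, union_subset hWS h3,
      fun h => h4 (h.subset subset_union_right)⟩
  · intro y hy
    by_cases hyS : y ∈ S
    · exact Or.inr hyS
    · left
      have : insert y W ⊆ W := IsPreconnected.subset_connectedComponentIn
        (hWc.subset_closure (subset_insert _ _) (insert_subset hy subset_closure))
        (mem_insert_of_mem _ haW) (insert_subset hyS hWS)
      exact this (mem_insert _ _)

theorem isCompact_compl_outer {S : Set ℂ} (hS : IsCompact S) : IsCompact (outer S)ᶜ := by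
  obtain ⟨R, hR0, hR⟩ := exists_pos_forall_norm_lt hS.isBounded
  refine Metric.isCompact_of_isClosed_isBounded (isOpen_outer hS.isClosed).isClosed_compl ?_
  refine isBounded_iff_forall_norm_le.2 ⟨R, fun z hz => ?_⟩
  by_contra! h
  exact hz (setOf_le_norm_subset_outer hR0.le hR h.le)

theorem isPreconnected_compl_outer {S : Set ℂ} (hS : IsCompact S) (hSc : IsConnected S) :
    IsPreconnected (outer S)ᶜ := by
  obtain ⟨s, hs⟩ := hSc.nonempty
  have hSo : S ⊆ (outer S)ᶜ := fun z hz h => outer_subset_compl S h hz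
  refine isPreconnected_of_forall s fun z hz => ?_
  by_cases hzS : z ∈ S
  · exact ⟨S, hSo, hs, hzS, hSc.isPreconnected⟩
  obtain ⟨W, hW, hWc, hzW, hWb, hWo, hWcl⟩ := exists_bounded_component hS.isClosed hzS hz
  obtain ⟨y, hyS, hyW⟩ : (S ∩ closure W).Nonempty := by
    by_contra hn
    have hcl : closure W ⊆ W := fun y hy => (hWcl hy).resolve_right
      fun h => hn ⟨y, h, hy⟩
    have : W = univ := IsClopen.eq_univ ⟨isClosed_of_closure_subset hcl, hW⟩ ⟨z, hzW⟩
    rw [this] at hWb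
    exact not_isBounded_of_setOf_le_norm_subset (R := 0) (subset_univ _) hWb
  refine ⟨S ∪ closure W, union_subset hSo ?_, Or.inl hs, Or.inr (subset_closure hzW),
    hSc.isPreconnected.union y hyS hyW hWc.closure⟩
  exact hWcl.trans (union_subset hWo hSo)

theorem not_exists_log_sub_on_sphere (a : ℂ) {ρ : ℝ} (hρ : 0 < ρ) {M : ℂ → ℂ}
    (hM : ContinuousOn M (Metric.sphere a ρ)) :
    ¬ ∀ z ∈ Metric.sphere a ρ, Complex.exp (M z) = z - a := by
  intro h
  have hmem : ∀ θ : ℝ, a + ρ * Complex.exp (θ * Complex.I) ∈ Metric.sphere a ρ := fun θ => by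
    rw [mem_sphere_iff_norm, add_sub_cancel_left, norm_mul, Complex.norm_exp_ofReal_mul_I,
      Complex.norm_real, mul_one, Real.norm_of_nonneg hρ.le]
  have := isPreconnected_univ.log_sub_log_eq (s := (univ : Set ℝ))
    (L := fun θ : ℝ => M (a + ρ * Complex.exp (θ * Complex.I)))
    (M := fun θ : ℝ => (Real.log ρ : ℂ) + θ * Complex.I)
    (hM.comp (Continuous.continuousOn (by fun_prop)) (fun θ _ => hmem θ))
    (Continuous.continuousOn (by fun_prop)) ?_ (mem_univ 0) (mem_univ (2 * Real.pi))
  · have h2 : Complex.exp ((2 * Real.pi : ℝ) * Complex.I) = 1 := by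
      push_cast; exact Complex.exp_two_pi_mul_I
    simp only [h2] at this
    simp at this
  · intro θ _
    rw [h _ (hmem θ), Complex.exp_add, ← Complex.ofReal_exp, Real.exp_log hρ]
    ring

/-- If nonvanishing continuous functions on a compact set have logarithms, the set does not
separate the plane. -/
theorem IsCompact.isPreconnected_compl_of_exists_log {D : Set ℂ} (hD : IsCompact D)
    (hlog : ∀ g : ℂ → ℂ, ContinuousOn g D → (∀ z ∈ D, g z ≠ 0) →
      ∃ L : ℂ → ℂ, ContinuousOn L D ∧ ∀ z ∈ D, Complex.exp (L z) = g z) :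
    IsPreconnected Dᶜ := by
  suffices Dᶜ ⊆ outer D by
    rw [this.antisymm (outer_subset_compl D)]
    exact isPreconnected_outer hD.isBounded
  intro a haD
  by_contra ha
  obtain ⟨W, hW, hWc, haW, hWb, -, hWcl⟩ := exists_bounded_component hD.isClosed haD ha
  obtain ⟨L₀, hL₀, hL₀e⟩ := hlog (fun z => z - a) (by fun_prop)
    (fun z hz h => haD (sub_eq_zero.1 h ▸ hz))
  obtain ⟨L, hL, hLe⟩ := hL₀.exists_continuous_eqOn hD.isClosed
  classical
  have hg : Continuous fun z => if z ∈ W then Complex.exp (L z) else z - a := by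
    refine continuous_if ?_ (by fun_prop) (by fun_prop)
    intro z hz
    have hz' : z ∈ frontier W := hz
    rw [hW.frontier_eq] at hz'
    have hzD : z ∈ D := (hWcl hz'.1).resolve_left hz'.2
    rw [hLe hzD, hL₀e z hzD]
  obtain ⟨M, hM, hMe⟩ := exists_log_of_starConvex (starConvex_univ 0) hg.continuousOn (fun z _ => by
    split_ifs with h
    · exact Complex.exp_ne_zero _
    · exact fun h' => h (sub_eq_zero.1 h' ▸ haW))
  obtain ⟨R, hR⟩ := hWb.subset_ball a
  refine not_exists_log_sub_on_sphere a (ρ := max R 1) (by positivity)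
    (hM.mono (subset_univ _)) fun z hz => ?_
  rw [hMe z (mem_univ z), if_neg]
  intro h
  have h1 := hR h
  rw [Metric.mem_ball, Metric.mem_sphere.1 hz] at h1
  exact (le_max_left R 1).not_gt h1

/-- A compact set not separating the plane is the intersection of its filled neighbourhoods. -/
theorem IsCompact.exists_mem_interior_outer_thickening {D : Set ℂ} (hD : IsCompact D)
    (hDc : IsPreconnected Dᶜ) {u : ℂ} (hu : u ∉ D) :
    ∃ δ > 0, ∀ δ' ≤ δ, Metric.ball u δ ⊆ outer (Metric.thickening δ' D) := by
  obtain ⟨R, hR0, hR⟩ := exists_pos_forall_norm_lt (hD.isBounded.thickening (δ := 1))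
  have hE := setOf_le_norm_subset_outer hR0.le hR
  have hRE : (R : ℂ) ∈ {z : ℂ | R ≤ ‖z‖} := by simp [abs_of_pos hR0]
  have hRD : (R : ℂ) ∈ Dᶜ := fun h => outer_subset_compl _ (hE hRE)
    (Metric.self_subset_thickening one_pos D h)
  have hpc : IsPathConnected Dᶜ := (hD.isClosed.isOpen_compl.isConnected_iff_isPathConnected).1
    ⟨⟨u, hu⟩, hDc⟩
  obtain ⟨γ, hγ⟩ := hpc.joinedIn u hu R hRD
  have hdis : Disjoint (range γ) D := by
    rw [Set.disjoint_left]
    rintro _ ⟨t, rfl⟩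
    exact hγ t
  obtain ⟨δ, hδ, hdis⟩ := hdis.exists_thickenings (isCompact_range γ.continuous) hD.isClosed
  have hcon : IsPreconnected (range γ) := isPreconnected_range γ.continuous
  refine ⟨min δ 1, by positivity, fun δ' hδ' => ?_⟩
  have huγ : u ∈ range γ := ⟨0, γ.source⟩
  have hRγ : (R : ℂ) ∈ range γ := ⟨1, γ.target⟩
  refine subset_trans ?_ (subset_outer (T := Metric.ball u (min δ 1) ∪ (range γ ∪ {z | R ≤ ‖z‖}))
    ?_ ?_ ?_)
  · exact subset_union_left
  · exact (convex_ball u _).isPreconnected.union u (Metric.mem_ball_self (by positivity))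
      (Or.inl huγ) (hcon.union (R : ℂ) hRγ hRE (isPreconnected_setOf_le_norm hR0.le))
  · have h1 : Metric.thickening δ (range γ) ⊆ (Metric.thickening δ' D)ᶜ := by
      intro z hz h
      exact (Set.disjoint_left.1 hdis hz)
        (Metric.thickening_mono (hδ'.trans (min_le_left _ _)) D h)
    refine union_subset ?_ (union_subset ?_ ?_)
    · refine subset_trans (fun z hz => ?_) h1
      exact Metric.mem_thickening_iff.2 ⟨u, huγ, lt_of_lt_of_le hz (min_le_left _ _)⟩
    · exact (Metric.self_subset_thickening hδ _).trans h1
    · intro z hz h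
      exact outer_subset_compl _ (hE hz) (Metric.thickening_mono (hδ'.trans (min_le_right _ _)) D h)
  · exact not_isBounded_of_setOf_le_norm_subset
      (subset_union_right.trans (subset_union_right : _ ⊆ Metric.ball u (min δ 1) ∪ _))

/-- A fixed point free situation: `F` has no fixed point on `O`, which is a union of components
of `U ∩ F '' U`, and the complement of `U` is connected and unbounded. -/
structure FreeState (F : ℂ ≃ₜ ℂ) (U O : Set ℂ) : Prop where
  log : HasLogQuotient F
  isOpen_domain : IsOpen U
  isPreconnected_compl : IsPreconnected Uᶜ
  not_isBounded_compl : ¬ Bornology.IsBounded Uᶜ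
  isOpen : IsOpen O
  isPreconnected : IsPreconnected O
  subset : O ⊆ U
  subset_image : O ⊆ F '' U
  isOpen_rest : IsOpen ((U ∩ F '' U) \ O)
  ne : ∀ p ∈ O, F p ≠ p

theorem exists_log_unitInterval {g : unitInterval → ℂ} (hg : Continuous g) (hne : ∀ t, g t ≠ 0) :
    ∃ L : unitInterval → ℂ, Continuous L ∧ ∀ t, Complex.exp (L t) = g t := by
  obtain ⟨L, hL, hLe, -⟩ := exists_log_homotopy (X := Unit) (fun p => g p.1) (by fun_prop)
    (fun p => hne p.1) (fun _ => Complex.log (g 0)) continuous_const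
    (fun _ => Complex.exp_log (hne 0))
  exact ⟨fun t => L (t, ()), by fun_prop, fun t => hLe (t, ())⟩

theorem exists_log_ratio {K B : Set ℂ} (hK : IsCompact K) (hKp : IsPreconnected K)
    (hKc : IsPreconnected Kᶜ) (hKB : Disjoint K B) {x : ℂ} (hx : x ∈ K) :
    ∃ H : ℂ × ℂ → ℂ, ContinuousOn H (K ×ˢ B) ∧
      ∀ p ∈ K, ∀ q ∈ B, (q - x) * Complex.exp (H (p, q)) = q - p := by
  have hne : ∀ p ∈ K, ∀ q ∈ B, q - p ≠ 0 := fun p hp q hq h =>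
    Set.disjoint_left.1 hKB hp (sub_eq_zero.1 h ▸ hq)
  have hex : ∀ q : ℂ, ∃ h : ℂ → ℂ, q ∈ B → ContinuousOn h K ∧ h x = 0 ∧
      ∀ p ∈ K, Complex.exp (h p) = (q - p) / (q - x) := by
    intro q
    by_cases hq : q ∈ B
    swap
    · exact ⟨0, fun h => absurd h hq⟩
    have hqx := hne x hx q hq
    obtain ⟨h, hh, he⟩ := hK.exists_log hKc (g := fun p => (q - p) / (q - x)) (by fun_prop)
      (fun p hp => div_ne_zero (hne p hp q hq) hqx)
    refine ⟨fun p => h p - h x, fun _ => ⟨by fun_prop, sub_self _, fun p hp => ?_⟩⟩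
    rw [Complex.exp_sub, he p hp, he x hx]
    field_simp
  choose h hh using hex
  refine ⟨fun z => h z.2 z.1, ?_, fun p hp q hq => ?_⟩
  swap
  · rw [(hh q hq).2.2 p hp, mul_div_cancel₀ _ (hne x hx q hq)]
  rintro ⟨p₀, q₀⟩ ⟨hp₀ : p₀ ∈ K, hq₀ : q₀ ∈ B⟩
  set ρ : ℂ → ℂ → ℂ := fun p q => ((q - p) * (q₀ - x)) / ((q - x) * (q₀ - p)) with hρ
  have hq₀x := hne x hx q₀ hq₀
  have hρ1 : ∀ p ∈ K, ρ p q₀ = 1 := by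
    intro p hp
    have := hne p hp q₀ hq₀
    simp only [hρ]; field_simp
  have hρc : ∀ p ∈ K, ContinuousAt (fun z : ℂ × ℂ => ρ z.2 z.1) (q₀, p) := by
    intro p hp
    have := hne p hp q₀ hq₀
    simp only [hρ]
    refine ContinuousAt.div (by fun_prop) (by fun_prop) (mul_ne_zero hq₀x this)
  have hev : ∀ᶠ q in 𝓝 q₀, ∀ p ∈ K, ρ p q ∈ Complex.slitPlane := by
    refine hK.eventually_forall_of_forall_eventually fun p hp => ?_
    refine (hρc p hp).eventually_mem (Complex.isOpen_slitPlane.mem_nhds ?_)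
    rw [hρ1 p hp]; exact Complex.one_mem_slitPlane
  have heq : ∀ᶠ q in 𝓝 q₀, q ∈ B → ∀ p ∈ K, h q p = h q₀ p + Complex.log (ρ p q) := by
    filter_upwards [hev] with q hq hqB p hp
    have hqx := hne x hx q hqB
    have := hKp.log_sub_log_eq (L := h q) (M := fun p => h q₀ p + Complex.log (ρ p q))
      (hh q hqB).1 ((hh q₀ hq₀).1.add (ContinuousOn.clog ?_ hq)) ?_ hp hx
    · have e : ρ x q = 1 := by simp only [hρ]; field_simp
      simp only [(hh q hqB).2.1, (hh q₀ hq₀).2.1, e] at this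
      simpa [sub_eq_zero] using this
    · simp only [hρ]
      exact ContinuousOn.div (by fun_prop) (by fun_prop)
        (fun p hp => mul_ne_zero hqx (hne p hp q₀ hq₀))
    · intro p hp
      have h1 := hne p hp q₀ hq₀
      have h2 := hne p hp q hqB
      rw [Complex.exp_add, Complex.exp_log (Complex.slitPlane_ne_zero (hq p hp)),
        (hh q hqB).2.2 p hp, (hh q₀ hq₀).2.2 p hp]
      simp only [hρ]; field_simp
  have hcont : ContinuousWithinAt (fun z : ℂ × ℂ => h q₀ z.1 + Complex.log (ρ z.1 z.2))
      (K ×ˢ B) (p₀, q₀) := by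
    refine ContinuousWithinAt.add ?_ ?_
    · exact ((hh q₀ hq₀).1 p₀ hp₀).comp continuousWithinAt_fst (fun z hz => hz.1)
    · refine ContinuousAt.continuousWithinAt (ContinuousAt.clog ?_ ?_)
      · exact ContinuousAt.comp (f := Prod.swap) (g := fun z : ℂ × ℂ => ρ z.2 z.1)
          (x := (p₀, q₀)) (hρc p₀ hp₀) continuous_swap.continuousAt
      · rw [hρ1 p₀ hp₀]; exact Complex.one_mem_slitPlane
  have hmem : (p₀, q₀) ∈ K ×ˢ B := ⟨hp₀, hq₀⟩
  refine hcont.congr_of_eventuallyEq_of_mem ?_ hmem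
  have h2 : ∀ᶠ z : ℂ × ℂ in 𝓝[K ×ˢ B] (p₀, q₀),
      z.2 ∈ B → ∀ p ∈ K, h z.2 p = h q₀ p + Complex.log (ρ p z.2) :=
    mem_nhdsWithin_of_mem_nhds ((continuous_snd.tendsto (p₀, q₀)).eventually heq)
  filter_upwards [h2, self_mem_nhdsWithin] with z hz hzm
  exact hz hzm.2 z.1 hzm.1

theorem FreeState.apply_apply_ne {F : ℂ ≃ₜ ℂ} {U O : Set ℂ} (h : FreeState F U O) {x : ℂ}
    (hx : x ∈ O) (hFx : F x ∈ O) : F (F x) ≠ x := by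
  intro hxx
  obtain ⟨Θ, hΘ, hΘs, hΘe⟩ := h.log
  have hA : IsOpen (F ⁻¹' O) := h.isOpen.preimage F.continuous
  have hAc : IsPreconnected (F ⁻¹' O) := by
    rw [← F.image_symm]
    exact h.isPreconnected.image _ F.symm.continuous.continuousOn
  have hpc : IsPathConnected (F ⁻¹' O) := (hA.isConnected_iff_isPathConnected).1
    ⟨⟨x, hFx⟩, hAc⟩
  have hFFx : F (F x) ∈ O := hxx.symm ▸ hx
  obtain ⟨α, hα⟩ := hpc.joinedIn x hFx (F x) hFFx
  have hαc : Continuous α := α.continuous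
  have hcO : ∀ t, F (α t) ∈ O := hα
  have hα0 : α 0 = x := α.source
  have hα1 : α 1 = F x := α.target
  have hαU : ∀ t, α t ∈ U := fun t => by
    obtain ⟨u, hu, e⟩ := h.subset_image (hcO t)
    rwa [← F.injective e]
  have hαne : ∀ t, α t ≠ F (α t) := fun t e => h.ne _ (e ▸ hcO t : α t ∈ O) e.symm
  set S : Set ℂ := range α ∪ range (fun t => F (α t)) with hS
  have hScomp : IsCompact S := (isCompact_range hαc).union
    (isCompact_range (F.continuous.comp hαc))
  have hScon : IsConnected S := by
    exact ⟨⟨x, Or.inl ⟨0, hα0⟩⟩, IsPreconnected.union (F x) ⟨1, hα1⟩ ⟨0, congrArg F hα0⟩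
      (isPreconnected_range hαc) (isPreconnected_range (F.continuous.comp hαc))⟩
  have hSU : S ⊆ U := by
    rintro _ (⟨t, rfl⟩ | ⟨t, rfl⟩)
    · exact hαU t
    · exact h.subset (hcO t)
  set K : Set ℂ := (outer S)ᶜ with hK
  have hKcomp : IsCompact K := isCompact_compl_outer hScomp
  have hKcon : IsPreconnected K := isPreconnected_compl_outer hScomp hScon
  have hKcc : IsPreconnected Kᶜ := by
    rw [hK, compl_compl]; exact isPreconnected_outer hScomp.isBounded
  have hSK : S ⊆ K := fun z hz hz' => outer_subset_compl S hz' hz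
  have hKU : K ⊆ U := by
    rw [hK, compl_subset_comm]
    exact subset_outer h.isPreconnected_compl (compl_subset_compl.2 hSU) h.not_isBounded_compl
  have hαK : ∀ t, α t ∈ K := fun t => hSK (Or.inl ⟨t, rfl⟩)
  have hcK : ∀ t, F (α t) ∈ K := fun t => hSK (Or.inr ⟨t, rfl⟩)
  have hxK : x ∈ K := hα0 ▸ hαK 0
  have hFxK : F x ∈ K := hα1 ▸ hαK 1
  have hFK : IsCompact (F '' K) := hKcomp.image F.continuous
  have hFKc : IsPreconnected (F '' K)ᶜ := by
    rw [← image_compl_eq F.bijective]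
    exact hKcc.image _ F.continuous.continuousOn
  set B : Set ℂ := F '' K ∩ (closure O \ O) with hB
  have hBcl : IsClosed B := hFK.isClosed.inter (isClosed_closure.sdiff h.isOpen)
  have hKB : Disjoint K B := by
    rw [Set.disjoint_left]
    rintro q hqK ⟨hqF, hqcl, hqO⟩
    obtain ⟨z, hz1, hz2⟩ := mem_closure_iff.1 hqcl _ h.isOpen_rest
      ⟨⟨hKU hqK, image_mono hKU hqF⟩, hqO⟩
    exact hz1.2 hz2
  obtain ⟨H₀, hH₀, hH₀e⟩ := exists_log_ratio hKcomp hKcon hKcc hKB hxK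
  obtain ⟨H, hH, hHe⟩ := hH₀.exists_continuous_eqOn (hKcomp.isClosed.prod hBcl)
  have hHB : ∀ p ∈ K, ∀ q ∈ B, (q - x) * Complex.exp (H (p, q)) = q - p := fun p hp q hq => by
    rw [hHe ⟨hp, hq⟩]
    exact hH₀e p hp q hq
  have hcover : F '' K = (F '' K ∩ closure O) ∪ (F '' K \ O) := by
    ext q
    have : q ∈ O → q ∈ closure O := fun h => subset_closure h
    simp only [mem_union, mem_inter_iff, Set.mem_sdiff]
    tauto
  have hcl1 : IsClosed (F '' K ∩ closure O) := hFK.isClosed.inter isClosed_closure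
  have hcl2 : IsClosed (F '' K \ O) := hFK.isClosed.sdiff h.isOpen
  classical
  let A : ℂ × ℂ → ℂ := fun z =>
    if z.2 ∈ O then z.2 - z.1 else (z.2 - x) * Complex.exp (H z)
  have hAcont : ContinuousOn A (K ×ˢ (F '' K)) := by
    rw [hcover, prod_union]
    refine ContinuousOn.union_of_isClosed ?_ ?_ (hKcomp.isClosed.prod hcl1)
      (hKcomp.isClosed.prod hcl2)
    · refine ContinuousOn.congr (f := fun z : ℂ × ℂ => z.2 - z.1) (by fun_prop) ?_
      rintro ⟨p, q⟩ ⟨hp, hq1, hq2⟩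
      by_cases hqO : q ∈ O
      · simp [A, hqO]
      · simp only [A, hqO, if_false]
        exact hHB p hp q ⟨hq1, hq2, hqO⟩
    · refine ContinuousOn.congr (f := fun z : ℂ × ℂ => (z.2 - x) * Complex.exp (H z))
        (by fun_prop) ?_
      rintro ⟨p, q⟩ ⟨hp, hq1, hq2⟩
      exact if_neg hq2
  have hne_x : ∀ q, q ∉ O → q - x ≠ 0 := fun q hq e => hq (sub_eq_zero.1 e ▸ hx)
  obtain ⟨M, hM, hMe⟩ := hKcomp.exists_log hKcc (g := fun p => A (p, F p))
    (hAcont.comp (by fun_prop) fun p hp => ⟨hp, mem_image_of_mem F hp⟩) (fun p hp => by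
      by_cases hO : F p ∈ O
      · simp only [A, hO, if_true]
        exact fun e => h.ne p ((sub_eq_zero.1 e) ▸ hO) (sub_eq_zero.1 e)
      · simp only [A, hO, if_false]
        exact mul_ne_zero (hne_x _ hO) (Complex.exp_ne_zero _))
  let r : unitInterval × ℂ → ℂ := fun z =>
    if z.2 ∈ O then 1 else (z.2 - x) * Complex.exp (H (F (α z.1), z.2)) / (z.2 - F (α z.1))
  have hne_c : ∀ t, ∀ q ∉ O, q - F (α t) ≠ 0 := fun t q hq e =>
    hq (sub_eq_zero.1 e ▸ hcO t)
  have hrcont : ContinuousOn r (univ ×ˢ (F '' K)) := by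
    rw [hcover, prod_union]
    refine ContinuousOn.union_of_isClosed ?_ ?_ (isClosed_univ.prod hcl1)
      (isClosed_univ.prod hcl2)
    · refine ContinuousOn.congr (f := fun z : unitInterval × ℂ => (1 : ℂ)) (by fun_prop) ?_
      rintro ⟨t, q⟩ ⟨-, hq1, hq2⟩
      by_cases hqO : q ∈ O
      · simp [r, hqO]
      · simp only [r, hqO, if_false]
        rw [hHB _ (hcK t) q ⟨hq1, hq2, hqO⟩, div_self (hne_c t q hqO)]
    · refine ContinuousOn.congr (f := fun z : unitInterval × ℂ =>
        (z.2 - x) * Complex.exp (H (F (α z.1), z.2)) / (z.2 - F (α z.1))) ?_ ?_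
      · refine ContinuousOn.div (by fun_prop) (by fun_prop) ?_
        rintro ⟨t, q⟩ ⟨-, -, hq2⟩
        exact hne_c t q hq2
      · rintro ⟨t, q⟩ ⟨-, hq1, hq2⟩
        exact if_neg hq2
  have hrne : ∀ t q, r (t, q) ≠ 0 := by
    intro t q
    by_cases hqO : q ∈ O
    · simp [r, hqO]
    · simp only [r, hqO, if_false]
      exact div_ne_zero (mul_ne_zero (hne_x _ hqO) (Complex.exp_ne_zero _)) (hne_c t q hqO)
  have hr1 : ∀ t, ∀ q ∈ O, r (t, q) = 1 := fun t q hq => if_pos hq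
  have hAr : ∀ t q, A (F (α t), q) = r (t, q) * (q - F (α t)) := by
    intro t q
    by_cases hqO : q ∈ O
    · simp [r, A, hqO]
    · simp only [r, A, hqO, if_false]
      rw [div_mul_cancel₀ _ (hne_c t q hqO)]
  have hcFK : ∀ t, F (α t) ∈ F '' K := fun t => mem_image_of_mem F (hαK t)
  have hFxFK : F x ∈ F '' K := mem_image_of_mem F hxK
  have hxFK : x ∈ F '' K := ⟨F x, hFxK, hxx⟩
  obtain ⟨N, hN, hNe⟩ := hFK.exists_log hFKc (g := fun q => r (0, q))
    (hrcont.comp (by fun_prop) fun q hq => ⟨mem_univ _, hq⟩) (fun q _ => hrne 0 q)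
  have hNeq : N x = N (F x) := by
    have := (isPreconnected_range (F.continuous.comp hαc)).log_sub_log_eq (L := N)
      (M := fun _ => 0) (hN.mono (range_subset_iff.2 hcFK)) continuousOn_const ?_
      (x := x) (y := F x) ⟨1, (congrArg F hα1).trans hxx⟩ ⟨0, congrArg F hα0⟩
    · simpa using this
    · rintro _ ⟨t, rfl⟩
      rw [Complex.exp_zero]
      exact (hNe _ (hcFK t)).trans (hr1 0 _ (hcO t))
  obtain ⟨L, hL, hLe, hL0⟩ := exists_log_homotopy (X := F '' K) (fun z => r (z.1, z.2))
    (hrcont.comp_continuous (by fun_prop) fun z => ⟨mem_univ _, z.2.2⟩) (fun z => hrne _ _)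
    (fun q => N q - N x) ((hN.comp_continuous continuous_subtype_val fun q => q.2).sub
      continuous_const) (fun q => by
        rw [Complex.exp_sub, hNe q q.2, hNe x hxFK, hr1 0 x hx, div_one])
  have hLconst : ∀ q : F '' K, (q : ℂ) ∈ O → L (1, q) = L (0, q) := by
    intro q hq
    have := isPreconnected_univ.log_sub_log_eq (s := (univ : Set unitInterval))
      (L := fun t => L (t, q)) (M := fun _ => 0)
      (Continuous.continuousOn (by fun_prop)) continuousOn_const (fun t _ => by
        rw [hLe, Complex.exp_zero]; exact hr1 t q hq) (mem_univ 1) (mem_univ 0)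
    simpa using this
  have hL0x : L (0, ⟨x, hxFK⟩) = 0 := by rw [hL0]; simp
  have hL1y : L (1, ⟨F x, hFxFK⟩) = 0 := by rw [hLconst _ hFx, hL0, hNeq]; simp
  obtain ⟨l, hl, hle⟩ := exists_log_unitInterval (g := fun t => F (α t) - α t)
    (by fun_prop) (fun t => sub_ne_zero.2 (hαne t).symm)
  have hstep1 := isPreconnected_univ.log_sub_log_eq (s := (univ : Set unitInterval))
    (L := fun t => M (α t)) (M := l) (hM.comp hαc.continuousOn fun t _ => hαK t)
    hl.continuousOn (fun t _ => by
      rw [hMe _ (hαK t), hle]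
      exact if_pos (hcO t)) (mem_univ 1) (mem_univ 0)
  have hstep2 := isPreconnected_univ.log_sub_log_eq (s := (univ : Set unitInterval))
    (L := fun t => M (F (α t)))
    (M := fun t => L (t, ⟨F (F (α t)), mem_image_of_mem F (hcK t)⟩) + l t + Θ (α t, F (α t)))
    (hM.comp (Continuous.continuousOn (by fun_prop)) fun t _ => hcK t)
    (by
      refine ContinuousOn.add (Continuous.continuousOn ?_) ?_
      · exact (hL.comp (by fun_prop)).add hl
      · exact hΘ.comp (Continuous.continuousOn (by fun_prop)) fun t _ => hαne t)
    (fun t _ => by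
      rw [hMe _ (hcK t), Complex.exp_add, Complex.exp_add, hLe, hle, hAr, mul_assoc,
        ← hΘe _ _ (hαne t)]) (mem_univ 1) (mem_univ 0)
  simp only [hα0, hα1, hxx, hL0x, hL1y] at hstep1 hstep2
  rw [hΘs _ _ (h.ne x hx)] at hstep2
  have hl01 : l 1 = l 0 := by linear_combination (-1 / 2) * (hstep1 + hstep2)
  have e1 := hle 1
  have e0 := hle 0
  simp only [hα0, hα1, hxx] at e0 e1
  rw [hl01, e0] at e1
  exact h.ne x hx (by linear_combination (1 / 2) * e1)

theorem FreeState.comp_push {F : ℂ ≃ₜ ℂ} {U O W : Set ℂ} (h : FreeState F U O) (hWU : W ⊆ U)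
    (hW : ∀ a ∈ W, F a ∈ W → F a ∉ O) {φ : ℂ ≃ₜ ℂ} (hφ : HasLogQuotient φ)
    (hφW : ∀ u ∉ W, φ u = u) : FreeState (φ.trans F) U O := by
  have himg : (φ.trans F) '' U = F '' U := by
    have hU : φ '' U = U := by
      ext u
      rw [← φ.preimage_symm, mem_preimage, ← Homeomorph.apply_mem_iff_of_eqOn_compl hφW hWU,
        φ.apply_symm_apply]
    change (F ∘ φ) '' U = F '' U
    rw [image_comp, hU]
  have hlog : HasLogQuotient (F ∘ φ) := h.log.comp hφ φ.continuous φ.injective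
  refine ⟨hlog, h.isOpen_domain,
    h.isPreconnected_compl, h.not_isBounded_compl, h.isOpen, h.isPreconnected, h.subset,
    himg ▸ h.subset_image, himg ▸ h.isOpen_rest, fun p hp hfp => ?_⟩
  rw [Homeomorph.trans_apply] at hfp
  by_cases hpW : p ∈ W
  · have := (Homeomorph.apply_mem_iff_of_eqOn_compl hφW subset_rfl p).2 hpW
    exact hW _ this (hfp.symm ▸ hpW) (hfp.symm ▸ hp)
  · rw [hφW p hpW] at hfp
    exact h.ne p hp hfp

/-- Closing an orbit segment whose ends lie in a free continuum. -/
theorem FreeState.exists_closing {F : ℂ ≃ₜ ℂ} {U O K : Set ℂ} (h : FreeState F U O)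
    (hK : IsCompact K) (hKp : IsPreconnected K) (hKU : K ⊆ U)
    (hfree : ∀ a ∈ K, F a ∈ K → F a ∉ O) {q : ℂ} {k : ℕ} (hq : q ∈ K)
    (hout : ∀ i, 1 ≤ i → i < k → F^[i] q ∉ K) (hkK : F^[k] q ∈ K) :
    ∃ F' : ℂ ≃ₜ ℂ, FreeState F' U O ∧ ∀ i, 1 ≤ i → i ≤ k → F'^[i] (F^[k] q) = F^[i] q := by
  set R := (U ∩ F '' U) \ O with hR
  have hGo : IsOpen ({z : ℂ × ℂ | F z.1 ≠ z.2} ∪ {z : ℂ × ℂ | F z.1 ∈ R}) := by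
    refine IsOpen.union (isOpen_ne_fun (by fun_prop) (by fun_prop)) ?_
    exact h.isOpen_rest.preimage (by fun_prop : Continuous fun z : ℂ × ℂ => F z.1)
  have hsub : K ×ˢ K ⊆ {z : ℂ × ℂ | F z.1 ≠ z.2} ∪ {z : ℂ × ℂ | F z.1 ∈ R} := by
    rintro ⟨a, b⟩ ⟨ha, hb⟩
    by_cases hab : F a = b
    · have hFa : F a ∈ K := hab.symm ▸ hb
      exact Or.inr ⟨⟨hKU hFa, mem_image_of_mem F (hKU ha)⟩, hfree a ha hFa⟩
    · exact Or.inl hab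
  obtain ⟨u, v, hu, hv, hKu, hKv, huv⟩ := generalized_tube_lemma hK hK hGo hsub
  set T : Set ℂ := (fun i => F^[i] q) '' (Ico 1 k) with hT
  have hTf : T.Finite := (finite_Ico 1 k).image _
  set N := (u ∩ v ∩ U) \ T with hN
  have hNo : IsOpen N := ((hu.inter hv).inter h.isOpen_domain).sdiff hTf.isClosed
  have hKN : K ⊆ N := by
    refine fun a ha => ⟨⟨⟨hKu ha, hKv ha⟩, hKU ha⟩, ?_⟩
    rintro ⟨i, hi, rfl⟩
    exact hout i hi.1 hi.2 ha
  set W := connectedComponentIn N q with hWdef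
  have hWo : IsOpen W := hNo.connectedComponentIn
  have hWN : W ⊆ N := connectedComponentIn_subset _ _
  have hKW : K ⊆ W := hKp.subset_connectedComponentIn hq hKN
  obtain ⟨φ, hφ, hφp, hφW⟩ := (isPreconnected_connectedComponentIn (x := q)
    (F := N)).exists_homeomorph_apply_eq hWo (hKW hkK) (hKW hq)
  refine ⟨φ.trans F, h.comp_push (fun a ha => (hWN ha).1.2) (fun a ha hFa hFO => ?_) hφ hφW, ?_⟩
  · rcases huv (mk_mem_prod (hWN ha).1.1.1 (hWN hFa).1.1.2) with h1 | h1
    · exact h1 rfl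
    · exact h1.2 hFO
  · intro i hi
    induction i, hi using Nat.le_induction with
    | base =>
      intro _
      simp [hφp]
    | succ i hi ih =>
      intro hik
      rw [Function.iterate_succ_apply', ih (by omega), Function.iterate_succ_apply',
        Homeomorph.trans_apply, hφW]
      intro hW
      exact (hWN hW).2 ⟨i, ⟨hi, by omega⟩, rfl⟩

theorem mem_ball_or_eq_of_mem_segment {x y w a : ℂ} {r : ℝ} (hy : y ∈ Metric.ball x r)
    (hw : w ∈ Metric.closedBall x r) (ha : a ∈ segment ℝ y w) : a ∈ Metric.ball x r ∨ a = w := by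
  obtain ⟨s, t, hs, ht, hst, rfl⟩ := ha
  rcases hs.eq_or_lt with rfl | hs
  · right
    obtain rfl : t = 1 := by linarith
    simp
  · left
    rw [mem_ball_iff_norm] at hy ⊢
    rw [mem_closedBall_iff_norm] at hw
    have e : s • y + t • w - x = s • (y - x) + t • (w - x) := by
      rw [smul_sub, smul_sub, sub_add_sub_comm, ← add_smul, hst, one_smul]
    rw [e]
    refine (norm_add_le _ _).trans_lt ?_
    rw [norm_smul, norm_smul, Real.norm_of_nonneg hs.le, Real.norm_of_nonneg ht]
    have hr : s * r + t * r = r := by rw [← add_mul, hst, one_mul]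
    linarith [mul_lt_mul_of_pos_left hy hs, mul_le_mul_of_nonneg_left hw ht]

/-- No free state has a cycle of length `k`. -/
def NoCycle (k : ℕ) : Prop :=
  ∀ (F : ℂ ≃ₜ ℂ) (U O : Set ℂ), FreeState F U O → ∀ x, (∀ i, 1 ≤ i → i ≤ k → F^[i] x ∈ O) →
    F^[k] x ≠ x

theorem NoCycle.false_of_closing {k : ℕ} (hk : NoCycle k) (hk1 : 1 ≤ k) {F : ℂ ≃ₜ ℂ}
    {U O K : Set ℂ} (h : FreeState F U O) (hK : IsCompact K) (hKp : IsPreconnected K) (hKU : K ⊆ U)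
    (hfree : ∀ a ∈ K, F a ∈ K → F a ∉ O) {q : ℂ} (hq : q ∈ K)
    (hO : ∀ i, 1 ≤ i → i ≤ k → F^[i] q ∈ O) (hout : ∀ i, 1 ≤ i → i < k → F^[i] q ∉ K)
    (hkK : F^[k] q ∈ K) : False := by
  obtain ⟨F', hF', hF'i⟩ := h.exists_closing hK hKp hKU hfree hq hout hkK
  exact hk F' U O hF' (F^[k] q) (fun i h1 h2 => hF'i i h1 h2 ▸ hO i h1 h2) (hF'i k hk1 le_rfl)

theorem FreeState.conj {F : ℂ ≃ₜ ℂ} {U O : Set ℂ} (h : FreeState F U O) {κ : ℂ ≃ₜ ℂ}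
    (hκ : HasLogQuotient κ) (hU : κ ⁻¹' U = U) :
    FreeState ((κ.trans F).trans κ.symm) U (κ ⁻¹' O) := by
  have hlog : HasLogQuotient (κ.symm ∘ (F ∘ κ)) :=
    (HasLogQuotient.symm hκ).comp (h.log.comp hκ κ.continuous κ.injective)
      (F.continuous.comp κ.continuous) (F.injective.comp κ.injective)
  have himg : ((κ.trans F).trans κ.symm) '' U = κ ⁻¹' (F '' U) := by
    change (κ.symm ∘ (F ∘ κ)) '' U = _
    rw [image_comp, image_comp, ← κ.image_symm]
    congr 2
    conv_lhs => rw [← hU]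
    exact image_preimage_eq _ κ.surjective
  have hsub : κ ⁻¹' O ⊆ U := fun a ha => hU ▸ h.subset ha
  refine ⟨hlog, h.isOpen_domain, h.isPreconnected_compl, h.not_isBounded_compl,
    h.isOpen.preimage κ.continuous, ?_, hsub, himg ▸ preimage_mono h.subset_image, ?_, ?_⟩
  · rw [← κ.image_symm]
    exact h.isPreconnected.image _ κ.symm.continuous.continuousOn
  · rw [himg]
    have := h.isOpen_rest.preimage κ.continuous
    rwa [preimage_sdiff, preimage_inter, hU] at this
  · intro p hp hfp
    refine h.ne _ hp ?_
    simpa [Homeomorph.trans_apply, κ.symm_apply_eq] using hfp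

theorem conj_iterate (F κ : ℂ ≃ₜ ℂ) (i : ℕ) (x : ℂ) :
    ((κ.trans F).trans κ.symm)^[i] x = κ.symm (F^[i] (κ x)) := by
  induction i with
  | zero => simp
  | succ i ih => rw [Function.iterate_succ_apply', ih, Function.iterate_succ_apply']; simp

theorem isCompact_segment (a b : ℂ) : IsCompact (segment ℝ a b) := by
  rw [segment_eq_image_lineMap]
  exact isCompact_Icc.image AffineMap.lineMap_continuous

theorem isPreconnected_segment (a b : ℂ) : IsPreconnected (segment ℝ a b) :=
  (convex_segment a b).isPreconnected

/-- If a homeomorphism moves an open ball off itself, then points of the closed ball mapped into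
the closed ball lie on the sphere, and so do their images. -/
theorem mem_sphere_of_ball_free {F : ℂ ≃ₜ ℂ} {x : ℂ} {r : ℝ} (hr : r ≠ 0)
    (hfree : ∀ a ∈ Metric.ball x r, F a ∉ Metric.ball x r) {u : ℂ}
    (hu : u ∈ Metric.closedBall x r) (hFu : F u ∈ Metric.closedBall x r) :
    u ∉ Metric.ball x r ∧ F u ∉ Metric.ball x r := by
  rw [← closure_ball x hr] at hu hFu
  constructor
  · intro hub
    have : F.symm ⁻¹' Metric.ball x r ∈ 𝓝 (F u) :=
      (Metric.isOpen_ball.preimage F.symm.continuous).mem_nhds (by simpa using hub)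
    obtain ⟨v, hv1, hv2⟩ := mem_closure_iff_nhds.1 hFu _ this
    exact hfree _ hv1 (by simpa using hv2)
  · intro hub
    have : F ⁻¹' Metric.ball x r ∈ 𝓝 u := (Metric.isOpen_ball.preimage F.continuous).mem_nhds hub
    obtain ⟨v, hv1, hv2⟩ := mem_closure_iff_nhds.1 hu _ this
    exact hfree _ hv2 hv1

theorem FreeState.false_of_critical_ball {F : ℂ ≃ₜ ℂ} {U O : Set ℂ} (h : FreeState F U O) {n : ℕ}
    (hn : 3 ≤ n) (ih : ∀ k, 1 ≤ k → k < n → NoCycle k) {x : ℂ} (horb : ∀ i, F^[i] x ∈ O)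
    (hper : F^[n] x = x) {r : ℝ} (hr : 0 < r) (hball : Metric.closedBall x r ⊆ F ⁻¹' O)
    (hfree : ∀ a ∈ Metric.ball x r, F a ∉ Metric.ball x r) {z : ℂ}
    (hz : z ∈ Metric.closedBall x r) (hFz : F z ∈ Metric.closedBall x r) : False := by
  have hOU : F ⁻¹' O ⊆ U := fun a ha => by
    obtain ⟨b, hb, hba⟩ := h.subset_image ha
    exact F.injective hba ▸ hb
  have hcbU := hball.trans hOU
  set B := Metric.ball x r with hB
  have hBcb : B ⊆ Metric.closedBall x r := Metric.ball_subset_closedBall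
  have hxB : x ∈ B := Metric.mem_ball_self hr
  have star : ∀ {u}, u ∈ Metric.closedBall x r → F u ∈ Metric.closedBall x r → u ∉ B ∧ F u ∉ B :=
    fun hu hFu => mem_sphere_of_ball_free hr.ne' hfree hu hFu
  have hnofix : ∀ a ∈ Metric.closedBall x r, F a ≠ a := fun a ha hfa =>
    h.ne a (by simpa [hfa] using hball ha) hfa
  have hseg : ∀ {a b c : ℂ}, a ∈ B → b ∈ Metric.closedBall x r → c ∈ segment ℝ a b → c ∈ B ∨ c = b :=
    fun ha hb hc => mem_ball_or_eq_of_mem_segment ha hb hc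
  have hsegcb : ∀ {a b : ℂ}, a ∈ B → b ∈ Metric.closedBall x r →
      segment ℝ a b ⊆ Metric.closedBall x r := fun ha hb =>
    (convex_closedBall x r).segment_subset (hBcb ha) hb
  obtain ⟨hzB, hwB⟩ := star hz hFz
  have hret : ∀ m, 1 ≤ m → m < n → ∀ y ∈ B, (∀ i, 1 ≤ i → i ≤ m → F^[i] y ∈ O) → F^[m] y ∉ B := by
    intro m
    induction m using Nat.strong_induction_on with
    | _ m ihm =>
      intro hm1 hmn y hy hyO hmy
      refine (ih m hm1 hmn).false_of_closing hm1 h (isCompact_segment y (F^[m] y))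
        (isPreconnected_segment _ _) ?_ ?_ (left_mem_segment ℝ _ _) hyO ?_
        (right_mem_segment ℝ _ _)
      · exact (hsegcb hy (hBcb hmy)).trans hcbU
      · intro a ha hFa
        exact absurd ((convex_ball x r).segment_subset hy hmy hFa)
          (hfree a ((convex_ball x r).segment_subset hy hmy ha))
      · intro i hi1 him hi
        exact ihm i him hi1 (by omega) y hy (fun j h1 h2 => hyO j h1 (by omega))
          ((convex_ball x r).segment_subset hy hmy hi)
  have horbB : ∀ i, 1 ≤ i → i < n → F^[i] x ∉ B := fun i h1 h2 =>
    hret i h1 h2 x hxB fun j _ _ => horb j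
  by_cases hzorb : ∃ i, 1 ≤ i ∧ i < n ∧ F^[i] x = z
  · classical
    obtain ⟨hi1, hin, hiz⟩ := Nat.find_spec hzorb
    have hmin := fun j => Nat.find_min hzorb (m := j)
    set i := Nat.find hzorb
    refine (ih i hi1 hin).false_of_closing hi1 h (isCompact_segment x z)
      (isPreconnected_segment _ _) ((hsegcb hxB hz).trans hcbU) ?_ (left_mem_segment ℝ _ _)
      (fun j _ _ => horb j) ?_ (hiz ▸ right_mem_segment ℝ _ _)
    · intro a ha hFa
      obtain ⟨h1, h2⟩ := star (hsegcb hxB hz ha) (hsegcb hxB hz hFa)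
      obtain rfl := (hseg hxB hz ha).resolve_left h1
      exact absurd ((hseg hxB hz hFa).resolve_left h2) (hnofix _ hz)
    · intro j hj1 hji hj
      rcases hseg hxB hz hj with h1 | h1
      · exact horbB j hj1 (by omega) h1
      · exact hmin j hji ⟨hj1, by omega, h1⟩
  set w := F z with hw
  have hworb : ∀ i, 1 ≤ i → i < n → F^[i] x ≠ w := by
    intro i hi1 hin hiw
    obtain ⟨j, rfl⟩ : ∃ j, i = j + 1 := ⟨i - 1, by omega⟩
    rw [Function.iterate_succ_apply'] at hiw
    have hjz := F.injective hiw
    rcases Nat.eq_zero_or_pos j with rfl | hj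
    · exact hzB (hjz ▸ hxB)
    · exact hzorb ⟨j, hj, by omega, hjz⟩
  set y := midpoint ℝ x w with hy
  have hyB : y ∈ B := by
    rw [hB, hy, Metric.mem_ball, dist_comm, dist_left_midpoint]
    have := Metric.mem_closedBall.1 hFz
    rw [dist_comm] at this
    norm_num
    linarith
  obtain ⟨ψ, hψ, hψx, hψB⟩ := exists_homeomorph_push x y (Metric.mem_ball.1 hyB)
  have h₁ : FreeState (ψ.trans F) U O :=
    h.comp_push (hBcb.trans hcbU) (fun a ha hFa => absurd hFa (hfree a ha)) hψ hψB
  set K := segment ℝ y w ∪ F '' segment ℝ x z with hK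
  have hdisj : ∀ a ∈ segment ℝ y w, a ∉ segment ℝ x z := by
    rintro _ ⟨s, t, hs, ht, hst, rfl⟩ ⟨s', t', -, ht', hst', e⟩
    have e1 : s • y + t • w - x = (s / 2 + t) • (w - x) := by
      have hyx : y - x = (1 / 2 : ℝ) • (w - x) := by rw [hy, midpoint_sub_left]; norm_num
      have : s • y + t • w - x = s • (y - x) + t • (w - x) := by
        rw [smul_sub, smul_sub, sub_add_sub_comm, ← add_smul, hst, one_smul]
      rw [this, hyx, smul_smul, ← add_smul]
      ring_nf
    have e2 : s • y + t • w - x = t' • (z - x) := by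
      rw [← e]
      have : s' • x + t' • z - x = s' • (x - x) + t' • (z - x) := by
        rw [smul_sub, smul_sub, sub_add_sub_comm, ← add_smul, hst', one_smul]
      rw [this, sub_self, smul_zero, zero_add]
    have hnw : ‖w - x‖ = r := le_antisymm (mem_closedBall_iff_norm.1 hFz)
      (not_lt.1 fun hlt => hwB (mem_ball_iff_norm.2 hlt))
    have hnz : ‖z - x‖ = r := le_antisymm (mem_closedBall_iff_norm.1 hz)
      (not_lt.1 fun hlt => hzB (mem_ball_iff_norm.2 hlt))
    have e3 := e1.symm.trans e2
    have e4 := congrArg norm e3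
    rw [norm_smul, norm_smul, hnw, hnz, Real.norm_of_nonneg (by positivity),
      Real.norm_of_nonneg ht'] at e4
    have e5 := mul_right_cancel₀ hr.ne' e4
    rw [← e5] at e3
    have hpos : s / 2 + t ≠ 0 := by linarith
    exact hnofix z hz (sub_left_injective (smul_right_injective ℂ hpos e3))
  have hKcompact : IsCompact K :=
    (isCompact_segment _ _).union ((isCompact_segment _ _).image F.continuous)
  have hKp : IsPreconnected K :=
    (isPreconnected_segment _ _).union w (right_mem_segment ℝ _ _)
      (mem_image_of_mem F (right_mem_segment ℝ _ _))
      ((isPreconnected_segment _ _).image _ F.continuous.continuousOn)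
  have hKU : K ⊆ U := by
    refine union_subset ((hsegcb hyB hFz).trans hcbU) ?_
    rintro _ ⟨a, ha, rfl⟩
    exact h.subset (hball (hsegcb hxB hz ha))
  have hiter : ∀ i, i < n → (ψ.trans F)^[i] (F x) = F^[i + 1] x := by
    intro i
    induction i with
    | zero => simp
    | succ i ihi =>
      intro hi
      rw [Function.iterate_succ_apply', ihi (by omega), Function.iterate_succ_apply' F (i + 1),
        Homeomorph.trans_apply, hψB _ (horbB _ (by omega) hi)]
  have hKpre : IsCompact (ψ ⁻¹' K) := by
    rw [← ψ.image_symm]; exact hKcompact.image ψ.symm.continuous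
  have hKprep : IsPreconnected (ψ ⁻¹' K) := by
    rw [← ψ.image_symm]; exact hKp.image _ ψ.symm.continuous.continuousOn
  refine (ih (n - 1) (by omega) (by omega)).false_of_closing (by omega) h₁ hKpre hKprep
    (q := F x) ?_ ?_ ?_ ?_ ?_ ?_
  · intro u hu
    exact (Homeomorph.apply_mem_iff_of_eqOn_compl hψB (hBcb.trans hcbU) u).1 (hKU hu)
  · intro b hb hFb hO
    rw [Homeomorph.trans_apply] at hFb hO
    rw [mem_preimage] at hb hFb
    have hnB : F (ψ b) ∉ B := by
      rcases hb with hb | ⟨a, ha, hab⟩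
      · exact fun hB => (star (hsegcb hyB hFz hb) (hBcb hB)).2 hB
      · rw [← hab] at hO ⊢
        rcases hseg hxB hz ha with h1 | rfl
        · refine hret 2 (by omega) (by omega) a h1 fun i hi1 hi2 => ?_
          obtain rfl | rfl : i = 1 ∨ i = 2 := by omega
          · exact hball (hBcb h1)
          · exact hO
        · exact fun hB => (star hFz (hBcb hB)).2 hB
    rw [hψB _ hnB] at hFb
    rcases hb with hb | ⟨a, ha, hab⟩
    · rcases hFb with hFb | ⟨c, hc, hcb⟩
      · obtain ⟨h1, h2⟩ := star (hsegcb hyB hFz hb) (hsegcb hyB hFz hFb)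
        have e1 := (hseg hyB hFz hb).resolve_left h1
        have e2 := (hseg hyB hFz hFb).resolve_left h2
        exact hnofix w hFz (e1 ▸ e2)
      · exact hdisj _ hb (F.injective hcb ▸ hc)
    · have hacb := hsegcb hxB hz ha
      have hFa : F a ∈ Metric.closedBall x r → a = z := fun h1 =>
        (hseg hxB hz ha).resolve_left (star hacb h1).1
      rcases hFb with hFb | ⟨c, hc, hcb⟩
      · have e1 := (hseg hyB hFz hFb).resolve_left hnB
        have e2 : F a = z := hab.trans (F.injective e1)
        have e3 := hFa (e2 ▸ hz)
        exact hnofix z hz (e3 ▸ e2)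
      · have e1 : c = F a := (F.injective hcb).trans hab.symm
        have e2 := hFa (e1 ▸ hsegcb hxB hz hc)
        rw [e1, e2] at hc
        exact hnofix z hz ((hseg hxB hz hc).resolve_left hwB)
  · rw [mem_preimage, show ψ (F x) = F x from hψB _ (horbB 1 le_rfl (by omega))]
    exact Or.inr (mem_image_of_mem F (left_mem_segment ℝ _ _))
  · intro i _ hi
    rw [hiter i (by omega)]
    exact horb _
  · intro i hi1 hi hiK
    rw [hiter i (by omega), mem_preimage, hψB _ (horbB _ (by omega) (by omega))] at hiK
    rcases hiK with hiK | ⟨a, ha, hai⟩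
    · rcases hseg hyB hFz hiK with h1 | h1
      · exact horbB _ (by omega) (by omega) h1
      · exact hworb _ (by omega) (by omega) h1
    · rw [Function.iterate_succ_apply'] at hai
      obtain rfl := F.injective hai
      rcases hseg hxB hz ha with h1 | h1
      · exact horbB _ hi1 (by omega) h1
      · exact hzorb ⟨_, hi1, by omega, h1⟩
  · rw [hiter _ (by omega), Nat.sub_add_cancel (by omega), hper, mem_preimage, hψx]
    exact Or.inl (left_mem_segment ℝ _ _)

theorem FreeState.exists_normalization {F : ℂ ≃ₜ ℂ} {U O : Set ℂ} (h : FreeState F U O) {x : ℂ}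
    (hx : x ∈ O) (hFx : F x ∈ O) (hFFx : F (F x) ∈ O) :
    ∃ κ : ℂ ≃ₜ ℂ, κ x = x ∧ FreeState ((κ.trans F).trans κ.symm) U (κ ⁻¹' O) ∧ ∃ η,
      Metric.closedBall x η ⊆ ((κ.trans F).trans κ.symm) ⁻¹' (κ ⁻¹' O) ∧
      dist (((κ.trans F).trans κ.symm) x) x = η := by
  set A := F ⁻¹' O with hA
  have hAo : IsOpen A := h.isOpen.preimage F.continuous
  have hAp : IsPreconnected A := by
    rw [hA, ← F.image_symm]
    exact h.isPreconnected.image _ F.symm.continuous.continuousOn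
  have hAU : A ⊆ U := fun a ha => by
    obtain ⟨b, hb, hba⟩ := h.subset_image ha
    exact F.injective hba ▸ hb
  obtain ⟨η, hη, hηA⟩ := Metric.nhds_basis_closedBall.mem_iff.1 (hAo.mem_nhds (show x ∈ A from hFx))
  set p : ℂ := x + η with hp
  have hpx : dist p x = η := by simp [hp, hη.le]
  have hWo : IsOpen (A \ {x}) := hAo.sdiff isClosed_singleton
  have hpne : p ≠ x := fun e => by rw [e, dist_self] at hpx; exact hη.ne hpx
  obtain ⟨κ, hκ, hκp, hκW⟩ := (IsPreconnected.diff_singleton hAo hAp x).exists_homeomorph_apply_eq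
    hWo (p := p) (q := F x) ⟨hηA (Metric.mem_closedBall.2 hpx.le), hpne⟩ ⟨hFFx, h.ne x hx⟩
  have hκx : κ x = x := hκW x (by simp)
  have hκA : ∀ u, κ u ∈ A ↔ u ∈ A := Homeomorph.apply_mem_iff_of_eqOn_compl hκW sdiff_subset
  have hκU : κ ⁻¹' U = U := by
    ext u
    exact Homeomorph.apply_mem_iff_of_eqOn_compl hκW (sdiff_subset.trans hAU) u
  refine ⟨κ, hκx, h.conj hκ hκU, η, fun u hu => ?_, ?_⟩
  · have : κ u ∈ A := (hκA u).2 (hηA hu)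
    simpa [hA] using this
  · simp only [Homeomorph.trans_apply, hκx]
    rw [← hκp, κ.symm_apply_apply, hpx]

theorem FreeState.false_of_ball {F : ℂ ≃ₜ ℂ} {U O : Set ℂ} (h : FreeState F U O) {n : ℕ}
    (hn : 3 ≤ n) (ih : ∀ k, 1 ≤ k → k < n → NoCycle k) {x : ℂ} (horb : ∀ i, F^[i] x ∈ O)
    (hper : F^[n] x = x) {η : ℝ} (hball : Metric.closedBall x η ⊆ F ⁻¹' O)
    (hη : dist (F x) x = η) : False := by
  have hS : IsCompact (Metric.closedBall x η ∩ F ⁻¹' Metric.closedBall x η) :=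
    (isCompact_closedBall x η).inter_right (Metric.isClosed_closedBall.preimage F.continuous)
  obtain ⟨z, ⟨hz, hFz⟩, hmin⟩ := hS.exists_isMinOn
    ⟨x, Metric.mem_closedBall_self (hη ▸ dist_nonneg), Metric.mem_closedBall.2 hη.le⟩
    (f := fun u => max (dist u x) (dist (F u) x))
    (Continuous.continuousOn (by fun_prop))
  set r := max (dist z x) (dist (F z) x) with hr
  have hrη : r ≤ η := max_le hz hFz
  have hr0 : 0 < r := by
    by_contra! hr0
    have h1 : z = x := dist_le_zero.1 ((le_max_left _ _).trans hr0)
    have h2 : F z = x := dist_le_zero.1 ((le_max_right _ _).trans hr0)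
    exact h.ne x (horb 0) (h1 ▸ h2)
  refine h.false_of_critical_ball hn ih horb hper hr0
    ((Metric.closedBall_subset_closedBall hrη).trans hball) (fun a ha hFa => ?_)
    (z := z) (Metric.mem_closedBall.2 (le_max_left _ _))
    (Metric.mem_closedBall.2 (le_max_right _ _))
  have h1 := Metric.mem_ball.1 ha
  have h2 := Metric.mem_ball.1 hFa
  have : r ≤ max (dist a x) (dist (F a) x) := hmin ⟨(h1.trans_le hrη).le, (h2.trans_le hrη).le⟩
  exact (max_lt h1 h2).not_ge this

theorem noCycle {n : ℕ} (hn : 1 ≤ n) : NoCycle n := by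
  induction n using Nat.strong_induction_on with
  | _ n ih =>
    intro F U O h x hO hper
    have horb : ∀ i, F^[i] x ∈ O := by
      intro i
      rw [← Function.IsPeriodicPt.iterate_mod_apply (show Function.IsPeriodicPt F n x from hper) i]
      rcases Nat.eq_zero_or_pos (i % n) with h0 | h0
      · rw [h0, Function.iterate_zero_apply, ← hper]
        exact hO n hn le_rfl
      · exact hO _ h0 (Nat.mod_lt _ hn).le
    obtain rfl | rfl | hn3 : n = 1 ∨ n = 2 ∨ 3 ≤ n := by omega
    · exact h.ne x (horb 0) hper
    · exact h.apply_apply_ne (horb 0) (horb 1) hper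
    · obtain ⟨κ, hκx, hκ, η, hball, hη⟩ := h.exists_normalization (x := x) (horb 0)
        (horb 1) (horb 2)
      refine hκ.false_of_ball hn3 (fun k hk1 hk => ih k hk hk1) (x := x) (fun i => ?_) ?_ hball hη
      · rw [conj_iterate, hκx, mem_preimage, κ.apply_symm_apply]
        exact horb i
      · rw [conj_iterate, hκx, hper, κ.symm_apply_eq, hκx]

theorem FreeState.exists_iterate_notMem {F : ℂ ≃ₜ ℂ} {U O C : Set ℂ} (h : FreeState F U O)
    (hC : IsCompact C) (hCO : C ⊆ O) (x : ℂ) : ∃ i, F^[i] x ∉ C := by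
  by_contra! horb
  obtain ⟨y, hy, φ, hφ, hlim⟩ := hC.tendsto_subseq horb
  have hev : ∀ᶠ z in 𝓝 y ×ˢ 𝓝 y, F z.1 ≠ z.2 := by
    rw [← nhds_prod_eq]
    exact (isOpen_ne_fun (by fun_prop) (by fun_prop) :
      IsOpen {z : ℂ × ℂ | F z.1 ≠ z.2}).mem_nhds (h.ne y (hCO hy))
  obtain ⟨s, hs, hsF⟩ := (Filter.eventually_prod_self_iff (r := fun a b => F a ≠ b)).1 hev
  obtain ⟨ε, hε, hball⟩ := Metric.mem_nhds_iff.1 (inter_mem hs (h.isOpen.mem_nhds (hCO hy)))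
  obtain ⟨N, hN⟩ := Filter.eventually_atTop.1 (hlim.eventually (Metric.ball_mem_nhds y hε))
  set q := F^[φ N] x with hq
  have hqb : q ∈ Metric.ball y ε := hN N le_rfl
  have hqit : ∀ k, F^[k] q = F^[k + φ N] x := fun k => (Function.iterate_add_apply F k _ x).symm
  have hex : ∃ k, 1 ≤ k ∧ F^[k] q ∈ Metric.ball y ε := by
    have hlt : φ N < φ (N + 1) := hφ (Nat.lt_succ_self N)
    refine ⟨φ (N + 1) - φ N, by omega, ?_⟩
    rw [hqit, Nat.sub_add_cancel hlt.le]
    exact hN (N + 1) (Nat.le_succ N)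
  classical
  obtain ⟨hk1, hk⟩ := Nat.find_spec hex
  have hmin := fun j => Nat.find_min hex (m := j)
  set k := Nat.find hex
  have hseg := (convex_ball y ε).segment_subset hqb hk
  refine (noCycle hk1).false_of_closing hk1 h (isCompact_segment q (F^[k] q))
    (isPreconnected_segment _ _) ((hseg.trans hball).trans (inter_subset_right.trans h.subset))
    (fun a ha hFa => ?_) (left_mem_segment ℝ _ _) (fun i _ _ => ?_) (fun i hi1 hik hi => ?_)
    (right_mem_segment ℝ _ _)
  · exact absurd rfl (hsF _ (hball (hseg ha)).1 _ (hball (hseg hFa)).1)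
  · rw [hqit]; exact hCO (horb _)
  · exact hmin i hik ⟨hi1, hseg hi⟩

theorem IsCompact.exists_isOpen_disjoint_connectedComponentIn {P Z : Set ℂ} (hP : IsCompact P)
    (hZ : IsClosed Z) {x : ℂ} (hx : x ∈ P) (hdisj : ∀ p ∈ connectedComponentIn P x, p ∉ Z) :
    ∃ V V' : Set ℂ, IsOpen V ∧ IsOpen V' ∧ Disjoint V V' ∧ P ⊆ V ∪ V' ∧ x ∈ V ∧
      ∀ p ∈ V, p ∉ Z := by
  have : CompactSpace P := isCompact_iff_compactSpace.1 hP
  have : Nonempty { s : Set P // IsClopen s ∧ (⟨x, hx⟩ : P) ∈ s } :=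
    ⟨⟨univ, isClopen_univ, mem_univ _⟩⟩
  obtain ⟨⟨s, hs, hxs⟩, hsZ⟩ := exists_subset_nhds_of_isCompact'
    (V := fun s : { s : Set P // IsClopen s ∧ (⟨x, hx⟩ : P) ∈ s } => (s : Set P))
    (U := {p : P | (p : ℂ) ∉ Z})
    (fun a b => ⟨⟨a ∩ b, a.2.1.inter b.2.1, a.2.2, b.2.2⟩, inter_subset_left, inter_subset_right⟩)
    (fun s => s.2.1.isClosed.isCompact) (fun s => s.2.1.isClosed) (fun p hp => by
      rw [← connectedComponent_eq_iInter_isClopen] at hp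
      refine (hZ.isOpen_compl.preimage continuous_subtype_val).mem_nhds (hdisj _ ?_)
      rw [connectedComponentIn_eq_image hx]
      exact mem_image_of_mem _ hp)
  have hQ : IsCompact ((↑) '' s : Set ℂ) := hs.isClosed.isCompact.image continuous_subtype_val
  have hQ' : IsCompact ((↑) '' sᶜ : Set ℂ) :=
    hs.compl.isClosed.isCompact.image continuous_subtype_val
  have hQQ : Disjoint ((↑) '' s : Set ℂ) ((↑) '' sᶜ) :=
    (disjoint_image_iff Subtype.val_injective).2 disjoint_compl_right
  obtain ⟨V, V', hV, hV', hQV, hQV', hd⟩ := SeparatedNhds.of_isCompact_isCompact hQ hQ' hQQ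
  refine ⟨V ∩ Zᶜ, V', hV.inter hZ.isOpen_compl, hV', hd.mono_left inter_subset_left, ?_,
    ⟨hQV ⟨_, hxs, rfl⟩, hsZ hxs⟩, fun p hp => hp.2⟩
  intro p hp
  by_cases hps : (⟨p, hp⟩ : P) ∈ s
  · exact Or.inl ⟨hQV ⟨_, hps, rfl⟩, hsZ hps⟩
  · exact Or.inr (hQV' ⟨_, hps, rfl⟩)

theorem IsCompact.exists_compl_outer_inter_image_subset {D V : Set ℂ} (hD : IsCompact D)
    (hDc : IsPreconnected Dᶜ) (F : ℂ ≃ₜ ℂ) (hV : IsOpen V) (hDV : D ∩ F '' D ⊆ V) :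
    ∃ δ > 0, (outer (Metric.thickening δ D))ᶜ ∩ F '' (outer (Metric.thickening δ D))ᶜ ⊆ V := by
  obtain ⟨R, hR0, hR⟩ := exists_pos_forall_norm_lt (hD.isBounded.thickening (δ := 1))
  have hE := setOf_le_norm_subset_outer hR0.le hR
  have hT : IsCompact (Metric.closedBall (0 : ℂ) R \ V) := IsCompact.diff (isCompact_closedBall 0 R) hV
  obtain ⟨δ, hδ, hδT⟩ : ∃ δ > 0, ∀ δ' ≤ δ, ∀ u ∈ Metric.closedBall (0 : ℂ) R \ V,
      u ∈ outer (Metric.thickening δ' D) ∨ F.symm u ∈ outer (Metric.thickening δ' D) := by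
    refine hT.induction_on (p := fun s => ∃ δ > 0, ∀ δ' ≤ δ, ∀ u ∈ s,
      u ∈ outer (Metric.thickening δ' D) ∨ F.symm u ∈ outer (Metric.thickening δ' D))
      ⟨1, one_pos, by simp⟩ ?_ ?_ ?_
    · rintro s t hst ⟨δ, hδ, h⟩
      exact ⟨δ, hδ, fun δ' h' u hu => h δ' h' u (hst hu)⟩
    · rintro s t ⟨δ₁, h₁, hs⟩ ⟨δ₂, h₂, ht⟩
      refine ⟨min δ₁ δ₂, lt_min h₁ h₂, fun δ' h' u hu => ?_⟩
      rcases hu with hu | hu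
      · exact hs δ' (h'.trans (min_le_left _ _)) u hu
      · exact ht δ' (h'.trans (min_le_right _ _)) u hu
    · rintro u ⟨-, hu⟩
      by_cases huD : u ∈ D
      · have huF : F.symm u ∉ D := fun h => hu (hDV ⟨huD, _, h, F.apply_symm_apply u⟩)
        obtain ⟨δ, hδ, h⟩ := hD.exists_mem_interior_outer_thickening hDc huF
        exact ⟨F.symm ⁻¹' Metric.ball (F.symm u) δ, mem_nhdsWithin_of_mem_nhds
          (F.symm.continuous.continuousAt.preimage_mem_nhds (Metric.ball_mem_nhds _ hδ)), δ, hδ,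
          fun δ' h' v hv => Or.inr (h δ' h' hv)⟩
      · obtain ⟨δ, hδ, h⟩ := hD.exists_mem_interior_outer_thickening hDc huD
        exact ⟨Metric.ball u δ, mem_nhdsWithin_of_mem_nhds (Metric.ball_mem_nhds _ hδ), δ, hδ,
          fun δ' h' v hv => Or.inl (h δ' h' hv)⟩
  refine ⟨min δ 1, lt_min hδ one_pos, ?_⟩
  rintro u ⟨hu, v, hv, rfl⟩
  by_contra huV
  have hball : F v ∈ Metric.closedBall (0 : ℂ) R := by
    rw [mem_closedBall_zero_iff]
    by_contra! hlt
    exact hu (outer_anti (Metric.thickening_mono (min_le_right _ _) D) (hE hlt.le))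
  rcases hδT _ (min_le_left _ _) _ ⟨hball, huV⟩ with h1 | h1
  · exact hu h1
  · exact hv (by simpa using h1)

theorem HasLogQuotient.exists_freeState {F : ℂ ≃ₜ ℂ} (hF : HasLogQuotient F) {D : Set ℂ}
    (hD : IsCompact D) (hDc : IsPreconnected Dᶜ) {x : ℂ} (hx : x ∈ D ∩ F '' D)
    (hfix : ∀ p ∈ connectedComponentIn (D ∩ F '' D) x, F p ≠ p) :
    ∃ U O, FreeState F U O ∧ connectedComponentIn (D ∩ F '' D) x ⊆ O := by
  have hP : IsCompact (D ∩ F '' D) := hD.inter (hD.image F.continuous)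
  obtain ⟨V, V', hV, hV', hVV, hPV, hxV, hVfix⟩ :=
    hP.exists_isOpen_disjoint_connectedComponentIn (Z := {p | F p = p})
      (isClosed_eq F.continuous continuous_id) hx hfix
  obtain ⟨δ, hδ, hUV⟩ := hD.exists_compl_outer_inter_image_subset hDc F (hV.union hV') hPV
  set S := Metric.thickening δ D with hS
  have hSo : IsOpen S := Metric.isOpen_thickening
  have hSb : Bornology.IsBounded S := hD.isBounded.thickening
  set U := (outer S)ᶜ with hU
  have hUo : IsOpen U := (isClosed_outer hSo hSb).isOpen_compl
  have hDU : D ⊆ U := (Metric.self_subset_thickening hδ D).trans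
    (subset_compl_comm.1 (outer_subset_compl S))
  set Q := U ∩ F '' U with hQ
  have hQo : IsOpen Q := hUo.inter (F.isOpenMap U hUo)
  have hPQ : D ∩ F '' D ⊆ Q := inter_subset_inter hDU (image_mono hDU)
  have hOQ : connectedComponentIn Q x ⊆ Q := connectedComponentIn_subset Q x
  refine ⟨U, connectedComponentIn Q x, ⟨hF, hUo, ?_, ?_, hQo.connectedComponentIn,
    isPreconnected_connectedComponentIn, hOQ.trans inter_subset_left, hOQ.trans inter_subset_right,
    ?_, ?_⟩, connectedComponentIn_mono x hPQ⟩
  · rw [hU, compl_compl]; exact isPreconnected_outer hSb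
  · rw [hU, compl_compl]; exact not_isBounded_outer hSb
  · rw [isOpen_iff_mem_nhds]
    rintro p ⟨hpQ, hp⟩
    refine mem_of_superset (hQo.connectedComponentIn.mem_nhds (mem_connectedComponentIn hpQ))
      fun u hu => ⟨connectedComponentIn_subset _ _ hu, fun hu' => hp ?_⟩
    rw [connectedComponentIn_eq hu', ← connectedComponentIn_eq hu]
    exact mem_connectedComponentIn hpQ
  · intro p hp
    exact hVfix p (isPreconnected_connectedComponentIn.subset_left_of_subset_union hV hV' hVV
      (hOQ.trans hUV) ⟨x, mem_connectedComponentIn (hPQ hx), hxV⟩ hp)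

theorem HasLogQuotient.exists_iterate_notMem {F : ℂ ≃ₜ ℂ} (hF : HasLogQuotient F) {D : Set ℂ}
    (hD : IsCompact D) (hDc : IsPreconnected Dᶜ) {x : ℂ} (hx : x ∈ D ∩ F '' D)
    (hfix : ∀ p ∈ connectedComponentIn (D ∩ F '' D) x, F p ≠ p) (y : ℂ) :
    ∃ i, F^[i] y ∉ connectedComponentIn (D ∩ F '' D) x := by
  obtain ⟨U, O, hUO, hCO⟩ := hF.exists_freeState hD hDc hx hfix
  have hP : IsCompact (D ∩ F '' D) := hD.inter (hD.image F.continuous)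
  refine hUO.exists_iterate_notMem (hP.of_isClosed_subset ?_ (connectedComponentIn_subset _ _))
    hCO y
  refine isClosed_of_closure_subset ?_
  exact isPreconnected_connectedComponentIn.closure.subset_connectedComponentIn
    (subset_closure (mem_connectedComponentIn hx))
    (closure_minimal (connectedComponentIn_subset _ _) hP.isClosed)

/-- The standard identification of `ℂ` with the plane. -/
def complexPlane : ℂ ≃ₜ Plane := Complex.orthonormalBasisOneI.repr.toHomeomorph

theorem norm_complexPlane (z : ℂ) : ‖complexPlane z‖ = ‖z‖ :=
  Complex.orthonormalBasisOneI.repr.norm_map z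

theorem IsJordanDomain.isCompact {D : Set Plane} (hD : IsJordanDomain D) : IsCompact D := by
  obtain ⟨h⟩ := hD
  have : CompactSpace (Metric.closedBall (0 : Plane) 1) :=
    isCompact_iff_compactSpace.1 (isCompact_closedBall 0 1)
  exact isCompact_iff_compactSpace.2 h.symm.compactSpace

theorem IsJordanDomain.isCompact_preimage {D : Set Plane} (hD : IsJordanDomain D) :
    IsCompact (complexPlane ⁻¹' D) := by
  rw [← complexPlane.image_symm]
  exact hD.isCompact.image complexPlane.symm.continuous

theorem IsJordanDomain.isPreconnected_compl_preimage {D : Set Plane} (hD : IsJordanDomain D) :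
    IsPreconnected (complexPlane ⁻¹' D)ᶜ := by
  refine hD.isCompact_preimage.isPreconnected_compl_of_exists_log fun g hg hne => ?_
  obtain ⟨h⟩ := hD
  have hball : ∀ z, z ∈ Metric.closedBall (0 : ℂ) 1 ↔
      complexPlane z ∈ Metric.closedBall (0 : Plane) 1 := fun z => by
    rw [mem_closedBall_zero_iff, mem_closedBall_zero_iff, norm_complexPlane]
  set α : Metric.closedBall (0 : ℂ) 1 → ℂ := fun z =>
    complexPlane.symm (h.symm ⟨complexPlane z, (hball z).1 z.2⟩) with hα
  have hαD : ∀ z, α z ∈ complexPlane ⁻¹' D := fun z => by simp [hα]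
  have hαc : Continuous α := by
    refine complexPlane.symm.continuous.comp (continuous_subtype_val.comp
      (h.symm.continuous.comp (Continuous.subtype_mk ?_ _)))
    exact complexPlane.continuous.comp continuous_subtype_val
  set β : (complexPlane ⁻¹' D) → ℂ := fun u => complexPlane.symm (h ⟨complexPlane u, u.2⟩) with hβ
  have hβc : Continuous β := by
    refine complexPlane.symm.continuous.comp (continuous_subtype_val.comp
      (h.continuous.comp (Continuous.subtype_mk ?_ _)))
    exact complexPlane.continuous.comp continuous_subtype_val
  have hβb : ∀ u, β u ∈ Metric.closedBall (0 : ℂ) 1 := fun u => by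
    rw [hball, hβ, complexPlane.apply_symm_apply]
    exact Subtype.mem _
  have hαβ : ∀ u, α ⟨β u, hβb u⟩ = u := fun u => by simp [hα, hβ]
  obtain ⟨G, hG, hGe⟩ := exists_continuousOn_extension (f := fun z => g (α z))
    (hg.comp_continuous hαc hαD)
  obtain ⟨L, hL, hLe⟩ := exists_log_of_starConvex
    ((convex_closedBall (0 : ℂ) 1).starConvex (Metric.mem_closedBall_self zero_le_one)) hG
    (fun z hz => by rw [hGe ⟨z, hz⟩]; exact hne _ (hαD _))
  obtain ⟨M, hM, hMe⟩ := exists_continuousOn_extension (f := fun u => L (β u))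
    (hL.comp_continuous hβc hβb)
  refine ⟨M, hM, fun u hu => ?_⟩
  rw [hMe ⟨u, hu⟩, hLe _ (hβb _), hGe ⟨_, hβb ⟨u, hu⟩⟩, hαβ]

theorem IsOrientationPreservingPlaneHomeo.hasLogQuotient {F : Plane ≃ₜ Plane}
    (hF : IsOrientationPreservingPlaneHomeo F) :
    HasLogQuotient ((complexPlane.trans F).trans complexPlane.symm) := by
  obtain ⟨H, hH, h0, h1, hb⟩ := hF
  refine hasLogQuotient_of_isotopy (fun t z => complexPlane.symm (H t (complexPlane z))) ?_ ?_ ?_ ?_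
  · exact complexPlane.symm.continuous.comp
      (hH.comp (continuous_fst.prodMk (complexPlane.continuous.comp continuous_snd)))
  · simp [h0]
  · simp [h1]
  · exact fun t ht => complexPlane.symm.injective.comp
      ((hb t ht).injective.comp complexPlane.injective)

/-- Let `D` be a Jordan domain, `f : D → E` an orientation-preserving
homeomorphism onto its image, and `C` a connected component of `D ∩ E`. If `f` has no
fixed point in `C`, then the non-escaping set of `f` in `C` is empty. -/
theorem jordan_nonescaping_empty (D E C : Set Plane) (f : Plane → Plane)
    (hD : IsJordanDomain D)
    (hf : IsHomeoOnto f D E)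
    (hor : OrientationPreservingOn f D)
    (hC : ∃ x ∈ D ∩ E, C = connectedComponentIn (D ∩ E) x)
    (hfix : ∀ p ∈ C, f p ≠ p) :
    {x : Plane | x ∈ C ∧ ∀ n : ℕ, f^[n] x ∈ C} = ∅ := by
  obtain ⟨x, hx, rfl⟩ := hC
  obtain ⟨F, hF, hFf⟩ := hor
  obtain rfl : f '' D = E := hf.2.2
  rw [hFf.image_eq] at hx hfix ⊢
  set e := complexPlane
  set G : ℂ ≃ₜ ℂ := (e.trans F).trans e.symm with hG
  have hGe : ∀ z, e (G z) = F (e z) := fun z => by simp [hG]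
  have himg : e ⁻¹' D ∩ G '' (e ⁻¹' D) = e.symm '' (D ∩ F '' D) := by
    rw [image_inter e.symm.injective, e.image_symm]
    congr 1
    ext z
    constructor
    · rintro ⟨w, hw, rfl⟩
      exact ⟨e w, hw, (hGe w).symm⟩
    · rintro ⟨w, hw, hwz⟩
      exact ⟨e.symm w, by simpa using hw, by simp [hG, hwz]⟩
  have hcomp : connectedComponentIn (e ⁻¹' D ∩ G '' (e ⁻¹' D)) (e.symm x) =
      e.symm '' connectedComponentIn (D ∩ F '' D) x := by
    rw [himg, e.symm.image_connectedComponentIn hx]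
  have hsubD : connectedComponentIn (D ∩ F '' D) x ⊆ D :=
    (connectedComponentIn_subset _ _).trans inter_subset_left
  refine eq_empty_of_forall_notMem fun y hy => ?_
  obtain ⟨-, hy⟩ := hy
  have hiter : ∀ n, G^[n] (e.symm y) = e.symm (f^[n] y) := by
    intro n
    induction n with
    | zero => rfl
    | succ n ih =>
      rw [Function.iterate_succ_apply', ih, Function.iterate_succ_apply', hFf (hsubD (hy n))]
      simp [hG]
  obtain ⟨i, hi⟩ := hF.hasLogQuotient.exists_iterate_notMem hD.isCompact_preimage
    hD.isPreconnected_compl_preimage (x := e.symm x) (himg ▸ mem_image_of_mem _ hx) (by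
      change ∀ p ∈ connectedComponentIn (e ⁻¹' D ∩ G '' (e ⁻¹' D)) (e.symm x), G p ≠ p
      rw [hcomp]
      rintro _ ⟨p, hp, rfl⟩ hGp
      refine hfix p hp ?_
      have := congrArg e hGp
      rwa [hGe, e.apply_symm_apply, ← hFf (hsubD hp)] at this) (e.symm y)
  refine hi ?_
  change G^[i] (e.symm y) ∈ connectedComponentIn (e ⁻¹' D ∩ G '' (e ⁻¹' D)) (e.symm x)
  rw [hcomp, hiter]
  exact mem_image_of_mem _ (hy i)
end
end

section
/- Let X be a compact subset of ℝⁿ (n ∈ ℕ) with at least two connected components, and let C and C' be two distinct connected components of X. Then for all sufficiently small ε > 0, the components C and C' lie in two distinct connected components of the closed ε-neighbourhood X_ε = { z ∈ ℝⁿ : inf_{x ∈ X} ‖x − z‖ ≤ ε }. -/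
open Set Filter Topology

noncomputable section

/-- Points of a compact set lying in different components are separated by two open sets which
cover some thickening of the set. -/
theorem IsCompact.exists_isOpen_thickening_subset_union {E : Type*} [MetricSpace E] {X : Set E}
    (hX : IsCompact X) {a b : E} (ha : a ∈ X) (hb : b ∈ X)
    (hab : connectedComponentIn X a ≠ connectedComponentIn X b) :
    ∃ δ > (0 : ℝ), ∃ U V : Set E, IsOpen U ∧ IsOpen V ∧ Disjoint U V ∧ a ∈ U ∧ b ∈ V ∧
      Metric.thickening δ X ⊆ U ∪ V := by
  have : CompactSpace X := isCompact_iff_compactSpace.mp hX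
  have hmem : (⟨b, hb⟩ : X) ∉ connectedComponent (⟨a, ha⟩ : X) := by
    intro h
    apply hab
    rw [connectedComponentIn_eq_image ha, connectedComponentIn_eq_image hb,
      connectedComponent_eq h]
  rw [connectedComponent_eq_iInter_isClopen, mem_iInter] at hmem
  push Not at hmem
  obtain ⟨⟨s, hs, has⟩, hbs⟩ := hmem
  have hA : IsCompact (Subtype.val '' s) := hs.isClosed.isCompact.image continuous_subtype_val
  have hB : IsCompact (Subtype.val '' sᶜ) :=
    hs.compl.isClosed.isCompact.image continuous_subtype_val
  have hAB : Disjoint (Subtype.val '' s) (Subtype.val '' sᶜ) :=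
    (disjoint_image_iff Subtype.val_injective).mpr disjoint_compl_right
  obtain ⟨δ, hδ, hdisj⟩ := hAB.exists_thickenings hA hB.isClosed
  refine ⟨δ, hδ, _, _, Metric.isOpen_thickening, Metric.isOpen_thickening, hdisj,
    Metric.self_subset_thickening hδ _ (mem_image_of_mem _ has),
    Metric.self_subset_thickening hδ _ ⟨⟨b, hb⟩, hbs, rfl⟩, ?_⟩
  rw [← Metric.thickening_union, ← image_union, union_compl_self, image_univ,
    Subtype.range_coe]

/-- If `X ⊂ ℝⁿ` is compact and `C ≠ C'` are connected components of `X`,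
then for all sufficiently small `ε > 0`, `C` and `C'` lie in distinct connected components
of the closed `ε`-neighbourhood `X_ε = {z : inf_{x ∈ X} ‖x - z‖ ≤ ε}`. -/
theorem separation_lemma (n : ℕ) (X : Set (EuclideanSpace ℝ (Fin n)))
    (hX : IsCompact X)
    (C C' : Set (EuclideanSpace ℝ (Fin n)))
    (hC : ∃ x ∈ X, C = connectedComponentIn X x)
    (hC' : ∃ x ∈ X, C' = connectedComponentIn X x)
    (hne : C ≠ C') :
    ∃ ε₀ > (0:ℝ), ∀ ε : ℝ, 0 < ε → ε ≤ ε₀ →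
      ∀ x ∈ C, ∀ y ∈ C',
        connectedComponentIn {z | Metric.infDist z X ≤ ε} x ≠
          connectedComponentIn {z | Metric.infDist z X ≤ ε} y := by
  obtain ⟨a, ha, rfl⟩ := hC
  obtain ⟨b, hb, rfl⟩ := hC'
  obtain ⟨δ, hδ, U, V, hU, hV, hUV, haU, hbV, hcover⟩ :=
    hX.exists_isOpen_thickening_subset_union ha hb hne
  have hXUV : X ⊆ U ∪ V := (Metric.self_subset_thickening hδ X).trans hcover
  refine ⟨δ / 2, half_pos hδ, fun ε hε hεδ x hx y hy heq => ?_⟩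
  have hsub : {z | Metric.infDist z X ≤ ε} ⊆ U ∪ V := fun z hz => hcover <|
    (Metric.mem_thickening_iff_infDist_lt ⟨a, ha⟩).mpr <|
      lt_of_le_of_lt (le_trans hz hεδ) (half_lt_self hδ)
  have hself : X ⊆ {z | Metric.infDist z X ≤ ε} := fun z hz =>
    (Metric.infDist_zero_of_mem hz).trans_le hε.le
  have hxU : x ∈ U := isPreconnected_connectedComponentIn.subset_left_of_subset_union hU hV hUV
    ((connectedComponentIn_subset X a).trans hXUV) ⟨a, mem_connectedComponentIn ha, haU⟩ hx
  have hyV : y ∈ V := isPreconnected_connectedComponentIn.subset_right_of_subset_union hU hV hUV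
    ((connectedComponentIn_subset X b).trans hXUV) ⟨b, mem_connectedComponentIn hb, hbV⟩ hy
  have hyU : y ∈ U := isPreconnected_connectedComponentIn.subset_left_of_subset_union hU hV hUV
    ((connectedComponentIn_subset _ x).trans hsub)
    ⟨x, mem_connectedComponentIn (hself (connectedComponentIn_subset X a hx)), hxU⟩
    (heq ▸ mem_connectedComponentIn (hself (connectedComponentIn_subset X b hy)))
  exact disjoint_left.mp hUV hyU hyV
end
end

section
/- Suppose f : ℝ² → ℝ² is an orientation-preserving homeomorphism of the plane. If f has a periodic point, then it has a fixed point. -/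
open Set Filter Topology

noncomputable section

/-- A continuous function with values in the fibres of `exp` over a single point is constant on
preconnected sets. -/
lemma eq_of_exp_eq_const {E : Type*} [TopologicalSpace E] {U : Set E} (hU : IsPreconnected U)
    {h : E → ℂ} (hh : ContinuousOn h U) {c : ℂ} (hc : ∀ x ∈ U, Complex.exp (h x) = c)
    {x y : E} (hx : x ∈ U) (hy : y ∈ U) : h x = h y := by
  have := Subtype.preconnectedSpace hU
  refine Complex.isCoveringMap_exp.const_of_comp (g := U.domRestrict h)
    (continuousOn_iff_continuous_domRestrict.1 hh) ?_ ⟨x, hx⟩ ⟨y, hy⟩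
  rintro ⟨a, ha⟩ ⟨b, hb⟩
  exact Subtype.ext ((hc a ha).trans (hc b hb).symm)

/-- A nowhere vanishing continuous function on an open convex set has a continuous logarithm. -/
lemma exists_continuousOn_log {E : Type*} [NormedAddCommGroup E] [NormedSpace ℝ E] {U : Set E}
    (hU : Convex ℝ U) (hUo : IsOpen U) (hne : U.Nonempty) {g : E → ℂ} (hg : ContinuousOn g U)
    (hg0 : ∀ x ∈ U, g x ≠ 0) :
    ∃ L : E → ℂ, ContinuousOn L U ∧ ∀ x ∈ U, Complex.exp (L x) = g x := by
  have := hU.contractibleSpace hne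
  have := hUo.locallyPathConnectedSpace
  obtain ⟨x₀, hx₀⟩ := hne
  let G : C(U, {z : ℂ // z ≠ 0}) :=
    ⟨fun x => ⟨g x, hg0 x x.2⟩, (continuousOn_iff_continuous_domRestrict.1 hg).subtype_mk _⟩
  obtain ⟨F, ⟨-, hF⟩, -⟩ := Complex.isCoveringMap_exp.existsUnique_continuousMap_lifts G
    ⟨x₀, hx₀⟩ (Complex.log (g x₀)) (Subtype.ext (Complex.exp_log (hg0 x₀ hx₀)))
  classical
  refine ⟨fun x => if hx : x ∈ U then F ⟨x, hx⟩ else 0, ?_, fun x hx => ?_⟩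
  · rw [continuousOn_iff_continuous_domRestrict]
    convert F.continuous using 1
    ext x
    simp
  · simp only [dif_pos hx]
    exact congrArg Subtype.val (congrFun hF ⟨x, hx⟩)

/-- An isotopy starting at the identity determines a continuous logarithm of the ratios
`(H 1 w - H 1 z) / (w - z)`, which is symmetric in `z` and `w`. -/
lemma exists_symm_log_ratio {H : ℝ → ℂ → ℂ} (hH : Continuous fun p : ℝ × ℂ => H p.1 p.2)
    (hH0 : ∀ z, H 0 z = z) (hinj : ∀ t ∈ Icc (0 : ℝ) 1, Function.Injective (H t)) :
    ∃ ρ : ℂ → ℂ → ℂ, ContinuousOn (fun p : ℂ × ℂ => ρ p.1 p.2) {p | p.1 ≠ p.2} ∧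
      (∀ z w, z ≠ w → Complex.exp (ρ z w) * (w - z) = H 1 w - H 1 z) ∧
      ∀ z w, z ≠ w → ρ z w = ρ w z := by
  let A := ↥{p : ℂ × ℂ | p.1 ≠ p.2}
  have hsub (p : A) : p.1.2 - p.1.1 ≠ 0 := sub_ne_zero.2 p.2.symm
  have hcont : Continuous fun q : unitInterval × {p : ℂ × ℂ | p.1 ≠ p.2} =>
      (H q.1 q.2.1.2 - H q.1 q.2.1.1) / (q.2.1.2 - q.2.1.1) := by
    refine Continuous.div ?_ (by fun_prop) fun q => hsub q.2
    exact (hH.comp (f := fun q : unitInterval × {p : ℂ × ℂ | p.1 ≠ p.2} =>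
        ((q.1 : ℝ), q.2.1.2)) (by fun_prop)).sub
      (hH.comp (f := fun q : unitInterval × {p : ℂ × ℂ | p.1 ≠ p.2} =>
        ((q.1 : ℝ), q.2.1.1)) (by fun_prop))
  let K : C(unitInterval × A, {z : ℂ // z ≠ 0}) :=
    ⟨fun q => ⟨_, div_ne_zero (sub_ne_zero.2 fun h => q.2.2 (hinj _ q.1.2 h).symm) (hsub q.2)⟩,
      hcont.subtype_mk _⟩
  have cov := Complex.isCoveringMap_exp
  have hK0 (p : A) : K (0, p) = ⟨_, Complex.exp_ne_zero ((0 : C(A, ℂ)) p)⟩ := by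
    apply Subtype.ext
    simp [K, hH0, div_self (hsub p)]
  let F := cov.liftHomotopy K 0 hK0
  have hF (q) : Complex.exp (F q) = K q :=
    congrArg Subtype.val (congrFun (cov.liftHomotopy_lifts K 0 hK0) q)
  have hF0 (p : A) : F (0, p) = 0 := cov.liftHomotopy_zero K 0 hK0 p
  classical
  refine ⟨fun z w => if h : z ≠ w then F (1, ⟨(z, w), h⟩) else 0, ?_, fun z w h => ?_,
    fun z w h => ?_⟩
  · rw [continuousOn_iff_continuous_domRestrict]
    convert! F.continuous.comp (Continuous.prodMk_right (1 : unitInterval)) using 1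
    ext ⟨x, hx⟩
    simp only [domRestrict_apply]
    exact dif_pos hx
  · have h' : w - z ≠ 0 := sub_ne_zero.2 h.symm
    simp only [dif_pos h, hF]
    simp [K, h']
  · simp only [dif_pos h, dif_pos h.symm]
    refine congrFun (cov.eq_of_comp_eq (g₁ := fun t => F (t, ⟨(z, w), h⟩))
      (g₂ := fun t => F (t, ⟨(w, z), h.symm⟩)) (by fun_prop) (by fun_prop) ?_ 0 ?_) 1
    · ext t
      simp only [Function.comp_apply, hF, K, ContinuousMap.coe_mk]
      rw [← neg_sub (H t w), ← neg_sub w z, neg_div_neg_eq]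
    · simp only [hF0]

/-- The key step of Brouwer's lemma on translation arcs: a fixed point free map isotopic to the
identity has no curve `γ (s + 1) = f (γ s)` with a closed subarc of parameter length `ℓ > 1`
such that `γ` has no self-intersection of smaller parameter length. -/
lemma false_of_minimal_loop {f : ℂ → ℂ} (hf : Continuous f) (hfix : ∀ z, f z ≠ z)
    {ρ : ℂ → ℂ → ℂ} (hρ : ContinuousOn (fun p : ℂ × ℂ => ρ p.1 p.2) {p | p.1 ≠ p.2})
    (hρf : ∀ z w, z ≠ w → Complex.exp (ρ z w) * (w - z) = f w - f z)
    (hρs : ∀ z w, z ≠ w → ρ z w = ρ w z)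
    {γ : ℝ → ℂ} (hγ : Continuous γ) (hγf : ∀ s, γ (s + 1) = f (γ s)) {a ℓ : ℝ} (hℓ : 1 < ℓ)
    (hγi : ∀ s d, 0 < d → d < ℓ → γ s ≠ γ (s + d)) (hloop : γ (a + ℓ) = γ a) : False := by
  obtain ⟨L, hL, hLe⟩ := exists_continuousOn_log (g := fun z => f z - z) convex_univ isOpen_univ
    univ_nonempty (by fun_prop) (fun z _ => sub_ne_zero.2 (hfix z))
  rw [continuousOn_univ] at hL
  replace hLe z := hLe z (mem_univ z)
  have hDc : Convex ℝ (univ ×ˢ Ioo (0 : ℝ) ℓ : Set (ℝ × ℝ)) := convex_univ.prod (convex_Ioo 0 ℓ)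
  obtain ⟨A, hA, hAe⟩ := exists_continuousOn_log
    (g := fun p : ℝ × ℝ => γ (p.1 + p.2) - γ p.1) hDc (isOpen_univ.prod isOpen_Ioo)
    ⟨(0, 1), by simp [hℓ]⟩ (by fun_prop)
    (fun p hp => sub_ne_zero.2 (hγi p.1 p.2 hp.2.1 hp.2.2).symm)
  have hA' {X : Type} [TopologicalSpace X] {U : Set X} {u v : X → ℝ} (hu : ContinuousOn u U)
      (hv : ContinuousOn v U) (h : ∀ x ∈ U, v x ∈ Ioo 0 ℓ) :
      ContinuousOn (fun x => A (u x, v x)) U :=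
    hA.comp (hu.prodMk hv) fun x hx => ⟨mem_univ _, h x hx⟩
  replace hAe s d (h0 : 0 < d) (h1 : d < ℓ) : Complex.exp (A (s, d)) = γ (s + d) - γ s :=
    hAe (s, d) ⟨mem_univ _, h0, h1⟩
  have hshift s d : γ (s + 1 + d) = f (γ (s + d)) := by rw [← hγf]; ring_nf
  have hsub s d (h0 : 0 < d) (h1 : d < ℓ) : γ (s + d) - γ s ≠ 0 :=
    sub_ne_zero.2 (hγi s d h0 h1).symm
  -- the three comparison functions, each of them locally constant
  have hAL s s' : A (s, 1) - L (γ s) = A (s', 1) - L (γ s') := by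
    refine eq_of_exp_eq_const isPreconnected_univ (h := fun s => A (s, 1) - L (γ s)) (c := 1)
      ((hA' continuousOn_id continuousOn_const fun _ _ => ⟨one_pos, hℓ⟩).sub
        (hL.comp hγ).continuousOn) (fun s _ => ?_) (mem_univ s) (mem_univ s')
    rw [Complex.exp_sub, hAe s 1 one_pos hℓ, hLe, hγf]
    exact div_self (sub_ne_zero.2 (hfix _))
  have hLρ z z' : L (f z) - L z - ρ z (f z) = L (f z') - L z' - ρ z' (f z') := by
    refine eq_of_exp_eq_const isPreconnected_univ (h := fun z => L (f z) - L z - ρ z (f z)) (c := 1)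
      (((hL.comp hf).sub hL).continuousOn.sub (hρ.comp (f := fun z => (z, f z))
        (by fun_prop) fun z _ => (hfix z).symm)) (fun z _ => ?_) (mem_univ z) (mem_univ z')
    have h := sub_ne_zero.2 (hfix z)
    rw [Complex.exp_sub, Complex.exp_sub, hLe, hLe, ← hρf z (f z) (hfix z).symm]
    field_simp [Complex.exp_ne_zero]
  have hAρ s d s' d' (hd : d ∈ Ioo 0 ℓ) (hd' : d' ∈ Ioo 0 ℓ) :
      A (s + 1, d) - A (s, d) - ρ (γ s) (γ (s + d)) =
        A (s' + 1, d') - A (s', d') - ρ (γ s') (γ (s' + d')) := by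
    refine eq_of_exp_eq_const hDc.isPreconnected (h := fun p : ℝ × ℝ =>
      A (p.1 + 1, p.2) - A (p.1, p.2) - ρ (γ p.1) (γ (p.1 + p.2))) (c := 1)
      (((hA' (by fun_prop) (by fun_prop) fun p hp => hp.2).sub
        (hA' (by fun_prop) (by fun_prop) fun p hp => hp.2)).sub
        (hρ.comp (f := fun p : ℝ × ℝ => (γ p.1, γ (p.1 + p.2))) (by fun_prop)
          fun p hp => hγi p.1 p.2 hp.2.1 hp.2.2)) ?_
      (show (s, d) ∈ _ from ⟨mem_univ _, hd⟩) (show (s', d') ∈ _ from ⟨mem_univ _, hd'⟩)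
    rintro ⟨s, d⟩ ⟨-, hd⟩
    have h := hsub s d hd.1 hd.2
    simp only
    rw [Complex.exp_sub, Complex.exp_sub, hAe _ _ hd.1 hd.2, hAe _ _ hd.1 hd.2, hshift, hγf,
      ← hρf _ _ (hγi s d hd.1 hd.2)]
    field_simp [Complex.exp_ne_zero]
  have hq d d' (hd : d ∈ Ioo 0 ℓ) (hd' : d' ∈ Ioo 0 ℓ) :
      A (a + d, ℓ - d) - A (a, d) = A (a + d', ℓ - d') - A (a, d') ∧
      Complex.exp (A (a + d, ℓ - d) - A (a, d)) = -1 := by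
    have key : ∀ d ∈ Ioo 0 ℓ, Complex.exp (A (a + d, ℓ - d) - A (a, d)) = -1 := by
      intro d hd
      rw [Complex.exp_sub, hAe _ _ (by linarith [hd.2]) (by linarith [hd.1]), hAe _ _ hd.1 hd.2,
        add_add_sub_cancel, hloop, ← neg_sub, neg_div, div_self (hsub a d hd.1 hd.2)]
    exact ⟨eq_of_exp_eq_const isPreconnected_Ioo (h := fun d => A (a + d, ℓ - d) - A (a, d))
      ((hA' (by fun_prop) (by fun_prop) fun d hd => ⟨by linarith [hd.2], by linarith [hd.1]⟩).sub
        (hA' (by fun_prop) (by fun_prop) fun d hd => hd)) key hd hd', key d hd⟩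
  have h1 : (1 : ℝ) ∈ Ioo 0 ℓ := ⟨one_pos, hℓ⟩
  have h2 : ℓ - 1 ∈ Ioo 0 ℓ := ⟨by linarith, by linarith⟩
  obtain ⟨e1, hneg⟩ := hq 1 (ℓ - 1) h1 h2
  rw [show ℓ - (ℓ - 1) = 1 by ring] at e1
  have hfz : f (γ (a + (ℓ - 1))) = γ a := by rw [← hγf, ← hloop]; ring_nf
  have e2 := hAL a (a + (ℓ - 1))
  have e3 := hAL (a + 1) a
  have e4 := hLρ (γ (a + (ℓ - 1))) (γ a)
  have e5 := hAρ a (ℓ - 1) a 1 h2 h1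
  rw [hfz, ← hρs _ _ (hγi a (ℓ - 1) h2.1 h2.2)] at e4
  rw [hγf] at e3 e5
  have : A (a + 1, ℓ - 1) - A (a, 1) = 0 := by
    linear_combination (1 / 2 : ℂ) * (e1 - e2 + e3 - e4 + e5)
  rw [this, Complex.exp_zero] at hneg
  norm_num at hneg

/-- For a fixed point free homeomorphism, every point lies in an open ball disjoint from its image
whose boundary contains a point together with its image. -/
lemma exists_maximal_free_ball {E : Type*} [NormedAddCommGroup E] [NormedSpace ℝ E]
    [ProperSpace E] (f : E ≃ₜ E) (hfix : ∀ z, f z ≠ z) (x : E) :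
    ∃ (r : ℝ) (y : E), 0 < r ∧ dist y x = r ∧ dist (f y) x = r ∧
      ∀ z, dist z x < r → ¬ dist (f z) x < r := by
  have hgc : Continuous fun z => max (dist z x) (dist (f z) x) := by fun_prop
  obtain ⟨y, hy⟩ := hgc.exists_forall_le
    (tendsto_atTop_mono (fun z => le_max_left _ _) (tendsto_dist_right_cocompact_atTop x))
  -- a point can be moved slightly towards `x`
  have hmove (w : E) (hw : w ≠ x) (U : Set E) (hU : U ∈ 𝓝 w) : ∃ w' ∈ U, dist w' x < dist w x := by
    have hc : Tendsto (fun t : ℝ => AffineMap.lineMap x w t) (𝓝[<] 1) (𝓝 w) := by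
      have : Continuous fun t : ℝ => (AffineMap.lineMap x w t : E) := by fun_prop
      simpa using (this.tendsto 1).mono_left nhdsWithin_le_nhds
    obtain ⟨t, htU, ht⟩ := ((hc.eventually hU).and (Ioo_mem_nhdsLT (zero_lt_one' ℝ))).exists
    refine ⟨_, htU, ?_⟩
    rw [dist_lineMap_left, dist_comm w x, Real.norm_of_nonneg ht.1.le]
    exact mul_lt_of_lt_one_left (dist_pos.2 hw.symm) ht.2
  have h0 : 0 < max (dist y x) (dist (f y) x) := by
    by_contra! h
    have h1 := dist_le_zero.1 ((le_max_left _ _).trans h)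
    have h2 := dist_le_zero.1 ((le_max_right _ _).trans h)
    exact hfix y (h2.trans h1.symm)
  have heq : dist y x = dist (f y) x := by
    rcases lt_trichotomy (dist y x) (dist (f y) x) with h | h | h
    · have hne : f y ≠ x := fun e => by simp [e] at h; linarith [dist_nonneg (x := y) (y := x)]
      obtain ⟨w, hwU, hw⟩ := hmove (f y) hne {w | dist (f.symm w) x < dist (f y) x}
        ((isOpen_lt (by fun_prop) continuous_const).mem_nhds (by simpa using h))
      have := hy (f.symm w)
      rw [f.apply_symm_apply, max_eq_right h.le] at this
      exact absurd (max_lt hwU hw) this.not_gt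
    · exact h
    · have hne : y ≠ x := fun e => by simp [e] at h; linarith [dist_nonneg (x := f x) (y := x)]
      obtain ⟨w, hwU, hw⟩ := hmove y hne {w | dist (f w) x < dist y x}
        ((isOpen_lt (by fun_prop) continuous_const).mem_nhds h)
      have := hy w
      rw [max_eq_left h.le] at this
      exact absurd (max_lt hw hwU) this.not_gt
  rw [heq, max_self] at hy h0
  exact ⟨dist (f y) x, y, h0, heq, rfl, fun z hz hz' => (hy z).not_gt (max_lt hz hz')⟩

/-- A path `α` from `y` to `f y` extends to a curve on which `f` acts as the unit translation. -/
lemma exists_translation_curve {X : Type*} [TopologicalSpace X] (f : X ≃ₜ X) {α : ℝ → X}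
    (hα : Continuous α) (h01 : α 1 = f (α 0)) :
    ∃ γ : ℝ → X, Continuous γ ∧ (∀ s, γ (s + 1) = f (γ s)) ∧ ∀ s ∈ Icc (0 : ℝ) 1, γ s = α s := by
  let γ : ℝ → X := fun s => (f ^ ⌊s⌋) (α (Int.fract s))
  have hγ (n : ℤ) (s : ℝ) (hs : s ∈ Icc (n : ℝ) (n + 1)) : γ s = (f ^ n) (α (s - n)) := by
    rcases hs.2.lt_or_eq with h | h
    · have : ⌊s⌋ = n := Int.floor_eq_iff.2 ⟨hs.1, h⟩
      simp only [γ, ← Int.self_sub_floor, this]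
    · have h' : ⌊s⌋ = n + 1 := by rw [h]; simp
      have : (s : ℝ) - n = 1 := by rw [h]; ring
      have hfr : Int.fract s = 0 := by rw [h]; simp
      simp only [γ, hfr, h', this, h01, zpow_add, zpow_one]
      rfl
  refine ⟨γ, ?_, fun s => ?_, fun s hs => by simpa using hγ 0 s (by simpa using hs)⟩
  · refine LocallyFinite.continuous (f := fun n : ℤ => Icc (n : ℝ) (n + 1)) ?_ ?_
      (fun n => isClosed_Icc) fun n => ?_
    · exact locallyFinite_Icc_of_tendsto tendsto_intCast_atTop_atTop
        (tendsto_atBot_add_const_right _ 1 (tendsto_intCast_atBot_iff.2 tendsto_id))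
    · exact iUnion_Icc_intCast ℝ
    · refine ContinuousOn.congr (f := fun s => (f ^ n) (α (s - n))) ?_ (hγ n)
      exact ((f ^ n).continuous.comp (hα.comp (by fun_prop))).continuousOn
  · simp only [γ, Int.floor_add_one, Int.fract_add_one, add_comm ⌊s⌋, zpow_add, zpow_one]
    rfl

/-- Every point of the plane lies on an arc `γ '' [0, 1]` which generates a translation curve for
the fixed point free homeomorphism `f`. -/
lemma exists_translation_arc (f : ℂ ≃ₜ ℂ) (hfix : ∀ z, f z ≠ z) (x : ℂ) :
    ∃ γ : ℝ → ℂ, Continuous γ ∧ (∀ s, γ (s + 1) = f (γ s)) ∧ γ (1 / 2) = x ∧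
      ∀ s ∈ Ico (0 : ℝ) 1, ∀ d, 0 < d → d ≤ 1 → γ s ≠ γ (s + d) := by
  obtain ⟨r, y, hr, hy, hfy, hfree⟩ := exists_maximal_free_ball f hfix x
  let α : ℝ → ℂ := fun s => x + (max (1 - 2 * s) 0 : ℝ) * (y - x) +
    (max (2 * s - 1) 0 : ℝ) * (f y - x)
  have hα : Continuous α := by fun_prop
  have hα1 {s : ℝ} (hs : s ≤ 1 / 2) : α s = x + (1 - 2 * s : ℝ) * (y - x) := by
    simp only [α]
    rw [max_eq_left (by linarith), max_eq_right (a := 2 * s - 1) (by linarith)]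
    simp
  have hα2 {s : ℝ} (hs : 1 / 2 ≤ s) : α s = x + (2 * s - 1 : ℝ) * (f y - x) := by
    simp only [α]
    rw [max_eq_right (a := 1 - 2 * s) (by linarith), max_eq_left (by linarith)]
    simp
  have hdist (s : ℝ) : dist (α s) x = |2 * s - 1| * r := by
    rcases le_total s (1 / 2) with hs | hs
    · rw [hα1 hs, dist_eq_norm, add_sub_cancel_left, norm_mul, ← dist_eq_norm, hy,
        Complex.norm_real, Real.norm_eq_abs, abs_sub_comm]
    · rw [hα2 hs, dist_eq_norm, add_sub_cancel_left, norm_mul, ← dist_eq_norm, hfy,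
        Complex.norm_real, Real.norm_eq_abs]
  have hball {s : ℝ} (h0 : 0 < s) (h1 : s < 1) : dist (α s) x < r := by
    rw [hdist]
    exact mul_lt_of_lt_one_left hr (abs_lt.2 ⟨by linarith, by linarith⟩)
  obtain ⟨γ, hγ, hγf, hγα⟩ := exists_translation_curve f hα
    (by rw [hα1 (s := 0) (by norm_num), hα2 (s := 1) (by norm_num)]; norm_num)
  refine ⟨γ, hγ, hγf, ?_, fun s hs d hd0 hd1 heq => ?_⟩
  · rw [hγα _ (by norm_num), hα1 le_rfl]
    norm_num
  rw [hγα s ⟨hs.1, hs.2.le⟩] at heq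
  rcases le_or_gt (s + d) 1 with h | h
  · rw [hγα _ ⟨by linarith [hs.1], h⟩] at heq
    have hab : |2 * s - 1| = |2 * (s + d) - 1| := by
      apply mul_right_cancel₀ hr.ne'
      rw [← hdist, ← hdist, heq]
    rcases abs_eq_abs.1 hab with h' | h'
    · linarith
    · rw [hα1 (by linarith), hα2 (by linarith), show 2 * (s + d) - 1 = 1 - 2 * s by linarith] at heq
      have hne : ((1 - 2 * s : ℝ) : ℂ) ≠ 0 := Complex.ofReal_ne_zero.2 (by linarith)
      exact hfix y (sub_left_injective (mul_left_cancel₀ hne (add_left_cancel heq))).symm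
  · have e : γ (s + d) = f (γ (s + d - 1)) := by rw [← hγf]; ring_nf
    rw [e, hγα _ ⟨by linarith, by linarith [hs.2]⟩] at heq
    exact hfree _ (hball (by linarith) (by linarith [hs.2]))
      (heq ▸ hball (s := s) (by linarith) hs.2)

/-- Brouwer's lemma for homeomorphisms of the complex plane. -/
lemma exists_fixed_point_complex (f : ℂ ≃ₜ ℂ) {H : ℝ → ℂ → ℂ}
    (hH : Continuous fun p : ℝ × ℂ => H p.1 p.2) (hH0 : ∀ z, H 0 z = z) (hH1 : ∀ z, H 1 z = f z)
    (hinj : ∀ t ∈ Icc (0 : ℝ) 1, Function.Injective (H t))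
    {x : ℂ} {n : ℕ} (hn : 1 ≤ n) (hx : f^[n] x = x) : ∃ z, f z = z := by
  by_contra! hfix
  obtain ⟨ρ, hρ, hρf, hρs⟩ := exists_symm_log_ratio hH hH0 hinj
  simp only [hH1] at hρf
  obtain ⟨γ, hγ, hγf, hγx, hγi⟩ := exists_translation_arc f hfix x
  have hnat (k : ℕ) (s : ℝ) : γ (s + k) = f^[k] (γ s) := by
    induction k with
    | zero => simp
    | succ k ih => rw [Function.iterate_succ_apply', ← ih, ← hγf]; push_cast; ring_nf
  have hint (k : ℤ) {s t : ℝ} : γ (s + k) = γ (t + k) ↔ γ s = γ t := by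
    obtain ⟨m, rfl | rfl⟩ := k.eq_nat_or_neg
    · simp only [Int.cast_natCast, hnat, (f.injective.iterate m).eq_iff]
    · rw [← (f.injective.iterate m).eq_iff, ← hnat, ← hnat]
      simp
  let S : Set (ℝ × ℝ) := (Icc 0 1 ×ˢ Icc 1 (n : ℝ)) ∩ {p | γ (p.1 + p.2) = γ p.1}
  have hS : IsCompact S := (isCompact_Icc.prod isCompact_Icc).inter_right
    (isClosed_eq (by fun_prop) (by fun_prop))
  have hS0 : ((1 / 2, n) : ℝ × ℝ) ∈ S :=
    ⟨⟨by norm_num, Nat.one_le_cast.2 hn, le_rfl⟩, by simp only [mem_ofPred_eq, hnat, hγx, hx]⟩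
  obtain ⟨⟨a, ℓ⟩, ⟨⟨-, hℓ⟩, hloop⟩, hmin⟩ := hS.exists_isMinOn ⟨_, hS0⟩ continuous_snd.continuousOn
  have hone : ℓ ≠ 1 := by
    rintro rfl
    exact hfix _ ((hγf a).symm.trans hloop)
  refine false_of_minimal_loop f.continuous hfix hρ hρf hρs hγ hγf (hℓ.1.lt_of_ne' hone)
    (fun s d hd0 hd1 heq => ?_) hloop
  have heq' : γ (Int.fract s) = γ (Int.fract s + d) := by
    rw [← hint ⌊s⌋, Int.fract_add_floor, heq, add_right_comm, Int.fract_add_floor]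
  have hs := Int.fract_nonneg s
  have hs' := Int.fract_lt_one s
  rcases le_or_gt d 1 with h | h
  · exact hγi _ ⟨hs, hs'⟩ d hd0 h heq'
  · exact hd1.not_ge (hmin (a := (Int.fract s, d)) ⟨⟨⟨hs, hs'.le⟩, h.le, hd1.le.trans hℓ.2⟩,
      heq'.symm⟩)

/-- Brouwer / Barge–Franks. An orientation-preserving homeomorphism
of the plane with a periodic point has a fixed point. -/
theorem plane_fixed_point_of_periodic (f : Plane ≃ₜ Plane)
    (hor : IsOrientationPreservingPlaneHomeo f)
    (hper : ∃ (x : Plane) (n : ℕ), 1 ≤ n ∧ (⇑f)^[n] x = x) :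
    ∃ x : Plane, f x = x := by
  obtain ⟨H, hH, hH0, hH1, hbij⟩ := hor
  obtain ⟨x, n, hn, hx⟩ := hper
  let e : ℂ ≃ₜ Plane := Complex.orthonormalBasisOneI.repr.toHomeomorph
  have hconj : Function.Semiconj e.symm f ((e.trans f).trans e.symm) := fun z => by simp
  obtain ⟨z, hz⟩ := exists_fixed_point_complex ((e.trans f).trans e.symm)
    (H := fun t z => e.symm (H t (e z)))
    (e.symm.continuous.comp (hH.comp (f := fun p : ℝ × ℂ => (p.1, e p.2)) (by fun_prop)))
    (fun z => by simp [hH0]) (fun z => by simp [hH1])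
    (fun t ht => e.symm.injective.comp ((hbij t ht).injective.comp e.injective)) hn
    (x := e.symm x) (by rw [← hconj.iterate_right n x, hx])
  exact ⟨e z, e.symm.injective (by simpa using hz)⟩
end
end

section
/- There exist a compact, simply connected, locally connected set X ⊂ ℝ² and a homeomorphism f : X → Y ⊂ ℝ² onto its image that is isotopic to the identity on X, such that f has a periodic point of period two (whose orbit meets two distinct connected components of X ∩ Y) but f has no fixed point. -/
open Set Filter Topology

noncomputable section

/-- The isotopy moving the segment `[-1, 1] × {0}` onto the parabolic arc over it with the
endpoints interchanged. -/
def arcIsotopy (t : ℝ) (p : Plane) : Plane :=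
  !₂[(1 - 2 * t) * p 0, p 1 + 4 * t * (1 - t) * p 0 + t * (1 - p 0 ^ 2)]

/-- The segment `[-1, 1] × {0}`. -/
def baseSegment : Set Plane := segment ℝ !₂[-1, 0] !₂[1, 0]

theorem mem_baseSegment {p : Plane} :
    p ∈ baseSegment ↔ p 0 ∈ Set.Icc (-1 : ℝ) 1 ∧ p 1 = 0 := by
  rw [baseSegment, segment_eq_image, Set.mem_image]
  constructor
  · rintro ⟨θ, hθ, rfl⟩
    obtain ⟨h0, h1⟩ := hθ
    simp only [PiLp.add_apply, PiLp.smul_apply, smul_eq_mul]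
    refine ⟨⟨?_, ?_⟩, ?_⟩ <;> simp <;> linarith
  · rintro ⟨⟨h0, h1⟩, h2⟩
    refine ⟨(1 + p 0) / 2, ⟨by linarith, by linarith⟩, ?_⟩
    ext i
    fin_cases i
    · simp
      ring
    · simp [h2]

theorem isCompact_baseSegment : IsCompact baseSegment := by
  rw [baseSegment, segment_eq_image]
  exact isCompact_Icc.image (by fun_prop)

theorem simplyConnectedSpace_baseSegment : SimplyConnectedSpace baseSegment := by
  have : ContractibleSpace baseSegment :=
    (convex_segment _ _).contractibleSpace ⟨_, left_mem_segment ℝ _ _⟩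
  infer_instance

theorem locallyConnectedSpace_baseSegment : LocallyConnectedSpace baseSegment := by
  have : LocallyPathConnectedSpace baseSegment := (convex_segment _ _).locallyPathConnectedSpace
  infer_instance

theorem continuous_arcIsotopy : Continuous fun q : ℝ × Plane => arcIsotopy q.1 q.2 := by
  unfold arcIsotopy
  refine (PiLp.continuous_toLp 2 _).comp (continuous_pi fun i => ?_)
  fin_cases i <;> simp <;> fun_prop

theorem injOn_arcIsotopy (t : ℝ) : Set.InjOn (arcIsotopy t) baseSegment := by
  intro p hp q hq h
  obtain ⟨⟨_, hp1⟩, hp2⟩ := mem_baseSegment.1 hp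
  obtain ⟨⟨_, hq1⟩, hq2⟩ := mem_baseSegment.1 hq
  have h0 : (1 - 2 * t) * p 0 = (1 - 2 * t) * q 0 := by
    simpa [arcIsotopy] using congrArg (fun r : Plane => r 0) h
  have h1 : p 1 + 4 * t * (1 - t) * p 0 + t * (1 - p 0 ^ 2) =
      q 1 + 4 * t * (1 - t) * q 0 + t * (1 - q 0 ^ 2) := by
    simpa [arcIsotopy] using congrArg (fun r : Plane => r 1) h
  have key : p 0 = q 0 := by
    by_cases ht : 1 - 2 * t = 0
    · obtain rfl : t = 1 / 2 := by linarith
      have : (p 0 - q 0) * (2 - p 0 - q 0) = 0 := by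
        rw [hp2, hq2] at h1
        linarith
      rcases mul_eq_zero.1 this with h | h <;> linarith
    · exact mul_left_cancel₀ ht h0
  ext i
  fin_cases i
  · exact key
  · exact hp2.trans hq2.symm

theorem arcIsotopy_zero (p : Plane) : arcIsotopy 0 p = p := by
  ext i
  fin_cases i <;> simp [arcIsotopy]

theorem arcIsotopy_one_ne_self (p : Plane) : arcIsotopy 1 p ≠ p := by
  intro h
  have h0 : (1 - 2 * 1) * p 0 = p 0 := congrArg (fun r : Plane => r 0) h
  have h1 : p 1 + 4 * 1 * (1 - 1) * p 0 + 1 * (1 - p 0 ^ 2) = p 1 :=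
    congrArg (fun r : Plane => r 1) h
  have : p 0 = 0 := by linarith
  rw [this] at h1
  linarith

/-- The segment and the arc meet only in points with first coordinate `±1`. -/
theorem sq_eq_one_of_mem_inter {p : Plane}
    (hp : p ∈ baseSegment ∩ arcIsotopy 1 '' baseSegment) : p 0 ^ 2 = 1 := by
  obtain ⟨hp, q, hq, rfl⟩ := hp
  have h1 : q 1 + 4 * 1 * (1 - 1) * q 0 + 1 * (1 - q 0 ^ 2) = 0 := (mem_baseSegment.1 hp).2
  have hq2 := (mem_baseSegment.1 hq).2
  change ((1 - 2 * 1) * q 0) ^ 2 = 1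
  linarith

/-- Points with first coordinates `1` and `-1` lie in different components of a planar set
contained in the lines `x = ±1`. -/
theorem connectedComponentIn_ne_of_sq_eq_one {S : Set Plane} (hS : ∀ p ∈ S, p 0 ^ 2 = 1)
    {a b : Plane} (ha : a ∈ S) (hb : b ∈ S) (ha0 : a 0 = 1) (hb0 : b 0 = -1) :
    connectedComponentIn S a ≠ connectedComponentIn S b := by
  intro h
  have hbC : b ∈ connectedComponentIn S a := h ▸ mem_connectedComponentIn hb
  have hconn : IsPreconnected ((fun p : Plane => p 0) '' connectedComponentIn S a) :=
    isPreconnected_connectedComponentIn.image _ (by fun_prop)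
  obtain ⟨p, hp, hp0⟩ := hconn.Icc_subset ⟨b, hbC, hb0⟩
    ⟨a, mem_connectedComponentIn ha, ha0⟩ (show (0 : ℝ) ∈ Set.Icc (-1) 1 by norm_num)
  have hsq := hS p (connectedComponentIn_subset S a hp)
  simp only at hp0
  norm_num [hp0] at hsq

/-- There exist a compact, simply connected, locally connected set
`X ⊂ ℝ²` and a homeomorphism `f : X → Y` onto its image, isotopic to the identity on `X`,
with a period-two point whose orbit meets two distinct connected components of `X ∩ Y`,
but with no fixed point. -/
theorem exists_period_two_no_fixed_point :
    ∃ (X Y : Set Plane) (f : Plane → Plane),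
      IsCompact X ∧ SimplyConnectedSpace ↥X ∧ LocallyConnectedSpace ↥X ∧
      IsHomeoOnto f X Y ∧ IsotopicToIdOn f X ∧
      (∃ x ∈ X ∩ Y, f x ∈ X ∩ Y ∧ f (f x) = x ∧ f x ≠ x ∧
        connectedComponentIn (X ∩ Y) x ≠ connectedComponentIn (X ∩ Y) (f x)) ∧
      (∀ p ∈ X, f p ≠ p) := by
  have hr : (!₂[1, 0] : Plane) ∈ baseSegment := right_mem_segment ℝ _ _
  have hl : (!₂[-1, 0] : Plane) ∈ baseSegment := left_mem_segment ℝ _ _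
  have hrl : arcIsotopy 1 !₂[1, 0] = !₂[-1, 0] := by
    ext i
    fin_cases i <;> norm_num [arcIsotopy]
  have hlr : arcIsotopy 1 !₂[-1, 0] = !₂[1, 0] := by
    ext i
    fin_cases i <;> norm_num [arcIsotopy]
  have hcont : Continuous (arcIsotopy 1) :=
    continuous_arcIsotopy.comp (Continuous.prodMk_right 1)
  refine ⟨baseSegment, arcIsotopy 1 '' baseSegment, arcIsotopy 1, isCompact_baseSegment,
    simplyConnectedSpace_baseSegment, locallyConnectedSpace_baseSegment,
    ⟨hcont.continuousOn, injOn_arcIsotopy 1, rfl⟩,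
    ⟨arcIsotopy, continuous_arcIsotopy.continuousOn, fun x _ => arcIsotopy_zero x,
      fun _ _ => rfl, fun t _ => injOn_arcIsotopy t⟩,
    ⟨!₂[1, 0], ⟨hr, _, hl, hlr⟩, ?_, ?_, arcIsotopy_one_ne_self _, ?_⟩,
    fun p _ => arcIsotopy_one_ne_self p⟩
  · rw [hrl]
    exact ⟨hl, _, hr, hrl⟩
  · rw [hrl, hlr]
  · rw [hrl]
    exact connectedComponentIn_ne_of_sq_eq_one (fun p hp => sq_eq_one_of_mem_inter hp)
      ⟨hr, _, hl, hlr⟩ ⟨hl, _, hr, hrl⟩ (by simp) (by simp)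
end
end
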